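/- arXiv:1807.06114 — 3 statements merged into one kernel-verified Lean document; each statement's English description precedes it below -/
import Mathlib

section
/- Assume the forward family (w_d) with I, θ and the backward family (w̃_c) with J, ϑ as in the context, and assume m₁ < n − 1 and m₂ < n − 1, so that θ(d) → −∞ as d → ∞ and ϑ(c) → +∞ as c → ∞. For integers i, j ≥ 0 define the exit times d_i = max{d ≥ 1 : θ(d) = −iπ} and c_j = max{c ≥ 1 : ϑ(c) = jπ}, and set x_i = |I(d_i)| and y_j = |J(c_j)|. Then the sequence (x_i)_{i ≥ 0} is either strictly monotone increasing or strictly monotone decreasing, the sequence (y_j)_{j ≥ 0} is either strictly monotone increasing or strictly monotone decreasing, and x₀ ≤ 1 and y₀ ≤ 1. -/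
section
open Set Filter Topology

lemma aux_lift (f g : ℝ × ℝ → ℝ) (hf : Continuous f) (hg : Continuous g)
    (hne : ∀ z, ¬ (f z = 0 ∧ g z = 0)) :
    ∃ Θ ρ : ℝ × ℝ → ℝ, Continuous Θ ∧
      ∀ z, 0 < ρ z ∧ f z = ρ z * Real.cos (Θ z) ∧ g z = ρ z * Real.sin (Θ z) := by
  let F : C(ℝ × ℝ, {z : ℂ // z ≠ 0}) :=
    ⟨fun z => ⟨(f z : ℂ) + (g z : ℂ) * Complex.I, by
      intro h
      apply hne z
      have h1 := congrArg Complex.re h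
      have h2 := congrArg Complex.im h
      simp at h1 h2
      exact ⟨h1, h2⟩⟩, by fun_prop⟩
  obtain ⟨G, ⟨-, hG⟩, -⟩ := Complex.isCoveringMap_exp.existsUnique_continuousMap_lifts F (0, 0)
    (Complex.log (F (0,0)).1) (Subtype.ext (Complex.exp_log (F (0,0)).2))
  refine ⟨fun z => (G z).im, fun z => Real.exp (G z).re, by fun_prop, fun z => ?_⟩
  have h := congrArg Subtype.val (congrFun hG z)
  have h' : Complex.exp (G z) = (f z : ℂ) + (g z : ℂ) * Complex.I := h
  have h1 := congrArg Complex.re h'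
  have h2 := congrArg Complex.im h'
  rw [Complex.exp_re] at h1
  rw [Complex.exp_im] at h2
  simp at h1 h2
  exact ⟨Real.exp_pos _, h1.symm, h2.symm⟩

lemma aux_cos (x : ℝ) (h : 0 < Real.cos x) : ∃ k : ℤ, x - k * (2 * Real.pi) ∈ Ioo (-(Real.pi/2)) (Real.pi/2) := by
  have hp := Real.pi_pos
  refine ⟨toIocDiv Real.two_pi_pos (-Real.pi) x, ?_⟩
  have h1 := sub_toIocDiv_zsmul_mem_Ioc Real.two_pi_pos (-Real.pi) x
  set k := toIocDiv Real.two_pi_pos (-Real.pi) x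
  rw [zsmul_eq_mul] at h1
  have h2 : Real.cos (x - k * (2 * Real.pi)) = Real.cos x := Real.cos_sub_int_mul_two_pi x k
  rw [← h2] at h
  set u := x - k * (2 * Real.pi)
  obtain ⟨ha, hb⟩ := h1
  constructor
  · by_contra hc
    push Not at hc
    have := Real.cos_nonpos_of_pi_div_two_le_of_le (x := -u) (by linarith) (by linarith)
    rw [Real.cos_neg] at this
    linarith
  · by_contra hc
    push Not at hc
    have := Real.cos_nonpos_of_pi_div_two_le_of_le (x := u) (by linarith) (by linarith)
    linarith

lemma aux_interval (s : Set ℝ) (hs : OrdConnected s) (hne : s.Nonempty) (hc : ∀ x ∈ s, 0 < Real.cos x) :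
    ∃ k : ℤ, s ⊆ Ioo (k * (2 * Real.pi) -(Real.pi/2)) (k * (2 * Real.pi) + Real.pi/2) := by
  have hp := Real.pi_pos
  obtain ⟨x, hx⟩ := hne
  obtain ⟨k, hk⟩ := aux_cos x (hc x hx)
  refine ⟨k, fun y hy => ?_⟩
  have e1 : Real.cos (k * (2 * Real.pi) -(Real.pi/2)) = 0 := by
    rw [sub_eq_neg_add, Real.cos_add_int_mul_two_pi]; simp
  have e2 : Real.cos (k * (2 * Real.pi) + (Real.pi/2)) = 0 := by
    rw [add_comm, Real.cos_add_int_mul_two_pi]; simp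
  obtain ⟨ha, hb⟩ := hk
  constructor
  · by_contra hcon
    push Not at hcon
    have := hc _ (hs.out hy hx ⟨hcon, by linarith⟩)
    linarith
  · by_contra hcon
    push Not at hcon
    have := hc _ (hs.out hx hy ⟨by linarith, hcon⟩)
    linarith

lemma aux_jump (s : Set ℝ) (hs : OrdConnected s) (hc : ∀ x ∈ s, 0 < Real.cos x)
    (e e' : ℝ) (he : e ∈ closure s) (he' : e' ∈ closure s) (h1 : Real.sin e = -1)
    (h2 : Real.sin e' = 1) : e' = e + Real.pi := by
  have hp := Real.pi_pos
  obtain ⟨k, hk⟩ := aux_interval s hs (closure_nonempty_iff.1 ⟨e, he⟩) hc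
  have hk' := (closure_mono hk).trans (closure_Ioo (by linarith)).subset
  have a := hk' he
  have b := hk' he'
  have a' : e - k * (2 * Real.pi) ∈ Icc (-(Real.pi/2)) (Real.pi/2) := ⟨by linarith [a.1], by linarith [a.2]⟩
  have b' : e' - k * (2 * Real.pi) ∈ Icc (-(Real.pi/2)) (Real.pi/2) := ⟨by linarith [b.1], by linarith [b.2]⟩
  have r1 := Real.injOn_sin a' (⟨le_rfl, by linarith⟩ : -(Real.pi/2) ∈ Icc (-(Real.pi/2)) (Real.pi/2))
    (by rw [Real.sin_sub_int_mul_two_pi, h1]; simp)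
  have r2 := Real.injOn_sin b' (⟨by linarith, le_rfl⟩ : (Real.pi/2) ∈ Icc (-(Real.pi/2)) (Real.pi/2))
    (by rw [Real.sin_sub_int_mul_two_pi, h2]; simp)
  linarith

/-- three-piece path -/
lemma aux_path (Θ : ℝ × ℝ → ℝ) (hΘ : Continuous Θ) (a0 a1 b0 b1 T : ℝ) (ha : a0 ≤ a1)
    (hb0 : b0 < T) (hb1 : b1 < T)
    (h1 : ∀ t ∈ Ioc b0 T, 0 < Real.cos (Θ (a0, t)))
    (h2 : ∀ s ∈ Icc a0 a1, 0 < Real.cos (Θ (s, T)))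
    (h3 : ∀ t ∈ Ioc b1 T, 0 < Real.cos (Θ (a1, t)))
    (hs : Real.sin (Θ (a0, b0)) = -1) (hs' : Real.sin (Θ (a1, b1)) = 1) :
    Θ (a1, b1) = Θ (a0, b0) + Real.pi := by
  have c1 : Continuous fun t => Θ (a0, t) := by fun_prop
  have c2 : Continuous fun s => Θ (s, T) := by fun_prop
  have c3 : Continuous fun t => Θ (a1, t) := by fun_prop
  let P : Set ℝ := (fun t => Θ (a0, t)) '' Ioc b0 T ∪ (fun s => Θ (s, T)) '' Icc a0 a1
      ∪ (fun t => Θ (a1, t)) '' Ioc b1 T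
  have hP : IsPreconnected P := by
    refine IsPreconnected.union (Θ (a1, T)) ?_ ?_ (IsPreconnected.union (Θ (a0, T)) ?_ ?_ ?_ ?_) ?_
    · exact Or.inr ⟨a1, ⟨ha, le_rfl⟩, rfl⟩
    · exact ⟨T, ⟨hb1, le_rfl⟩, rfl⟩
    · exact ⟨T, ⟨hb0, le_rfl⟩, rfl⟩
    · exact ⟨a0, ⟨le_rfl, ha⟩, rfl⟩
    · exact isPreconnected_Ioc.image _ c1.continuousOn
    · exact isPreconnected_Icc.image _ c2.continuousOn
    · exact isPreconnected_Ioc.image _ c3.continuousOn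
  refine aux_jump P hP.ordConnected ?_ _ _ ?_ ?_ hs hs'
  · rintro x ((⟨t, ht, rfl⟩ | ⟨t, ht, rfl⟩) | ⟨t, ht, rfl⟩)
    exacts [h1 t ht, h2 t ht, h3 t ht]
  · refine closure_mono (subset_union_left.trans subset_union_left)
      (image_closure_subset_closure_image c1 ⟨b0, ?_, rfl⟩)
    rw [closure_Ioc hb0.ne]; exact ⟨le_rfl, hb0.le⟩
  · refine closure_mono subset_union_right
      (image_closure_subset_closure_image c3 ⟨b1, ?_, rfl⟩)
    rw [closure_Ioc hb1.ne]; exact ⟨le_rfl, hb1.le⟩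

lemma aux_far (f : ℝ → ℝ) (hf : Continuous f) (ht : Tendsto f atTop atBot) (g : ℝ → ℝ)
    (hg : Continuous g) (a b c : ℝ) : ∃ S, c < S ∧ ∀ t ∈ Icc a b, f S < g t := by
  obtain ⟨m, hm⟩ := (isCompact_Icc (a := a) (b := b)).bddBelow_image hg.continuousOn
  obtain ⟨S, hS, hS'⟩ := ((ht.eventually_lt_atBot m).and (eventually_gt_atTop c)).exists
  exact ⟨S, hS', fun t h => hS.trans_le (hm ⟨t, h, rfl⟩)⟩

lemma aux_order (f r g q : ℝ → ℝ) (hf : Continuous f) (hr : Continuous r) (hg : Continuous g)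
    (hq : Continuous q) (hft : Tendsto f atTop atBot) (hgt : Tendsto g atTop atBot)
    (a0 a1 b0 b1 u0 u1 : ℝ) (ha : a0 ≤ a1) (hb : b0 ≤ b1)
    (hfa0 : f a0 = u0) (hgb0 : g b0 = u0) (hfa1 : f a1 = u1) (hgb1 : g b1 = u1)
    (hf0 : ∀ s > a0, f s < u0) (hg0 : ∀ s > b0, g s < u0)
    (hf1 : ∀ s > a1, f s < u1) (hg1 : ∀ s > b1, g s < u1)
    (hdis : ∀ s ≥ a0, ∀ t ≥ b0, ¬ (f s = g t ∧ r s = q t))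
    (hlt : r a0 < q b0) : r a1 < q b1 := by
  by_contra hcon
  have hne : r a1 ≠ q b1 := fun h => hdis a1 ha b1 hb ⟨hfa1.trans hgb1.symm, h⟩
  have hgt' : q b1 < r a1 := lt_of_le_of_ne (not_lt.1 hcon) hne.symm
  obtain ⟨Θ, ρ, hΘ, h⟩ := aux_lift (fun z => f (max a0 z.1) - g (max b0 z.2))
    (fun z => r (max a0 z.1) - q (max b0 z.2)) (by fun_prop) (by fun_prop)
    (fun z hz => hdis (max a0 z.1) (le_max_left _ _) (max b0 z.2) (le_max_left _ _)
      ⟨by linarith [hz.1], by linarith [hz.2]⟩)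
  have key : ∀ s t, a0 ≤ s → b0 ≤ t → 0 < ρ (s,t) ∧ f s - g t = ρ (s,t) * Real.cos (Θ (s,t)) ∧
      r s - q t = ρ (s,t) * Real.sin (Θ (s,t)) := by
    intro s t hs ht
    have := h (s,t)
    simpa [max_eq_right hs, max_eq_right ht] using this
  have kpos : ∀ s t, a0 ≤ s → b0 ≤ t → g t < f s → 0 < Real.cos (Θ (s,t)) := by
    intro s t hs ht hl
    obtain ⟨k1, k2, -⟩ := key s t hs ht
    have : 0 < ρ (s,t) * Real.cos (Θ (s,t)) := by linarith
    exact (mul_pos_iff_of_pos_left k1).1 this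
  have kneg : ∀ s t, a0 ≤ s → b0 ≤ t → f s < g t → 0 < Real.cos (Θ (s,t) + Real.pi) := by
    intro s t hs ht hl
    obtain ⟨k1, k2, -⟩ := key s t hs ht
    rw [Real.cos_add_pi]
    have : 0 < ρ (s,t) * (-Real.cos (Θ (s,t))) := by linarith
    exact (mul_pos_iff_of_pos_left k1).1 this
  have ksin0 : Real.sin (Θ (a0,b0)) = -1 := by
    obtain ⟨k1, k2, k3⟩ := key a0 b0 le_rfl le_rfl
    have hc : Real.cos (Θ (a0,b0)) = 0 := by
      have : ρ (a0,b0) * Real.cos (Θ (a0,b0)) = 0 := by rw [← k2, hfa0, hgb0]; ring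
      exact (mul_eq_zero.1 this).resolve_left k1.ne'
    have := Real.sin_sq_add_cos_sq (Θ (a0,b0))
    rw [hc] at this
    have hsn : Real.sin (Θ (a0,b0)) < 0 := by
      by_contra hh
      have := mul_nonneg k1.le (not_lt.1 hh)
      linarith
    nlinarith
  have ksin1 : Real.sin (Θ (a1,b1)) = 1 := by
    obtain ⟨k1, k2, k3⟩ := key a1 b1 ha hb
    have hc : Real.cos (Θ (a1,b1)) = 0 := by
      have : ρ (a1,b1) * Real.cos (Θ (a1,b1)) = 0 := by rw [← k2, hfa1, hgb1]; ring
      exact (mul_eq_zero.1 this).resolve_left k1.ne'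
    have := Real.sin_sq_add_cos_sq (Θ (a1,b1))
    rw [hc] at this
    have hsn : 0 < Real.sin (Θ (a1,b1)) := by
      have : 0 < ρ (a1,b1) * Real.sin (Θ (a1,b1)) := by linarith
      exact (mul_pos_iff_of_pos_left k1).1 this
    nlinarith
  obtain ⟨T, hT, hT'⟩ := aux_far g hg hgt f hf a0 a1 b1
  obtain ⟨S, hS, hS'⟩ := aux_far f hf hft g hg b0 b1 a1
  have e1 := aux_path Θ hΘ a0 a1 b0 b1 T ha (by linarith) hT
    (fun t ht => kpos _ _ le_rfl ht.1.le (by rw [hfa0]; exact hg0 t ht.1))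
    (fun s hs => kpos _ _ hs.1 (by linarith) (hT' s hs))
    (fun t ht => kpos _ _ ha (by linarith [ht.1]) (by rw [hfa1]; exact hg1 t ht.1)) ksin0 ksin1
  have e2 := aux_path (fun z => -(Θ (z.2, z.1) + Real.pi)) (by fun_prop) b0 b1 a0 a1 S hb (by linarith) hS
    (fun t ht => by
      simp only [Real.cos_neg]
      exact kneg _ _ ht.1.le le_rfl (by rw [hgb0]; exact hf0 t ht.1))
    (fun t ht => by
      simp only [Real.cos_neg]
      exact kneg _ _ (by linarith) ht.1 (hS' t ht))
    (fun t ht => by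
      simp only [Real.cos_neg]
      exact kneg _ _ (by linarith [ht.1]) hb (by rw [hgb1]; exact hf1 t ht.1))
    (by simp only [Real.sin_neg, Real.sin_add_pi]; linarith)
    (by simp only [Real.sin_neg, Real.sin_add_pi]; linarith)
  simp only at e2
  linarith [Real.pi_pos]

structure AuxSol (k : ℝ → ℝ) (lam p a : ℝ) (w v : ℝ → ℝ) : Prop where
  cw : Continuous w
  cv : Continuous v
  hw : ∀ r ∈ Ioo 0 a, HasDerivAt w (v r) r
  hv : ∀ r ∈ Ioo 0 a, HasDerivAt v (-(k r * v r) - lam * (|w r| ^ (p - 1) * w r - w r)) r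

lemma aux_lip (p M : ℝ) (hp : 1 < p) : ∃ L : ℝ, 0 ≤ L ∧ ∀ x y : ℝ, |x| ≤ M → |y| ≤ M →
    |(|x| ^ (p-1) * x) - (|y| ^ (p-1) * y)| ≤ L * |x - y| := by
  rcases lt_or_ge M 0 with hM | hM
  · exact ⟨0, le_rfl, fun x y hx => absurd (abs_nonneg x) (by linarith)⟩
  have hL : 0 ≤ p * M ^ (p-1) := by positivity
  have base : ∀ x ∈ Icc 0 M, ∀ y ∈ Icc 0 M, |x ^ p - y ^ p| ≤ (p * M ^ (p-1)) * |x - y| := by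
    intro x hx y hy
    have := (convex_Icc (0:ℝ) M).norm_image_sub_le_of_norm_hasDerivWithin_le
      (f := fun x : ℝ => x ^ p) (f' := fun x => p * x ^ (p-1)) (C := p * M ^ (p-1))
      (fun x hx => (Real.hasDerivAt_rpow_const (Or.inr hp.le)).hasDerivWithinAt)
      (fun x hx => by
        rw [Real.norm_of_nonneg (mul_nonneg (by linarith) (Real.rpow_nonneg hx.1 _))]
        exact mul_le_mul_of_nonneg_left (Real.rpow_le_rpow hx.1 hx.2 (by linarith)) (by linarith)) hy hx
    simpa using this
  have split : ∀ x : ℝ, |x| ^ (p-1) * x = (max x 0) ^ p - (max (-x) 0) ^ p := by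
    intro x
    rcases le_total 0 x with h | h
    · rw [abs_of_nonneg h, max_eq_left h, max_eq_right (by linarith), Real.zero_rpow (by linarith), sub_zero]
      rcases h.eq_or_lt with rfl | h'
      · simp [Real.zero_rpow (by linarith : p ≠ 0)]
      · nth_rewrite 2 [← Real.rpow_one x]
        rw [← Real.rpow_add h']; ring_nf
    · rw [abs_of_nonpos h, max_eq_right h, max_eq_left (by linarith), Real.zero_rpow (by linarith), zero_sub]
      rcases h.eq_or_lt with rfl | h'
      · simp [Real.zero_rpow (by linarith : p ≠ 0)]
      · have : (-x) ^ p = (-x) ^ (p-1) * (-x) := by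
          nth_rewrite 3 [← Real.rpow_one (-x)]
          rw [← Real.rpow_add (by linarith)]; ring_nf
        rw [this]; ring
  refine ⟨2 * (p * M ^ (p-1)), by positivity, fun x y hx hy => ?_⟩
  rw [abs_le] at hx hy
  rw [split, split]
  have e1 := base (max x 0) ⟨le_max_right _ _, max_le hx.2 hM⟩ (max y 0) ⟨le_max_right _ _, max_le hy.2 hM⟩
  have e2 := base (max (-x) 0) ⟨le_max_right _ _, max_le (by linarith) hM⟩ (max (-y) 0)
    ⟨le_max_right _ _, max_le (by linarith) hM⟩
  have f1 : |max x 0 - max y 0| ≤ |x - y| := abs_max_sub_max_le_abs x y 0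
  have f2 : |max (-x) 0 - max (-y) 0| ≤ |x - y| := by
    have := abs_max_sub_max_le_abs (-x) (-y) 0
    rwa [show -x - -y = -(x - y) by ring, abs_neg] at this
  have g1 := mul_le_mul_of_nonneg_left f1 hL
  have g2 := mul_le_mul_of_nonneg_left f2 hL
  calc _ = |((max x 0) ^ p - (max y 0)^p) - ((max (-x) 0)^p - (max (-y) 0)^p)| := by ring_nf
    _ ≤ _ := abs_sub _ _
    _ ≤ _ := by linarith

lemma AuxSol.cf {k : ℝ → ℝ} {lam p a : ℝ} {w v : ℝ → ℝ} (h : AuxSol k lam p a w v) (hp : 1 < p) :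
    Continuous fun r => lam * (|w r| ^ (p - 1) * w r - w r) := by
  have := h.cw
  have h1 : Continuous fun r => |w r| ^ (p-1) := by
    exact (continuous_abs.comp this).rpow_const (fun x => Or.inr (by linarith))
  fun_prop

lemma AuxSol.left {k : ℝ → ℝ} {lam p a : ℝ} {w v : ℝ → ℝ} (h : AuxSol k lam p a w v) (hp : 1 < p)
    (hk : ContinuousOn k (Ioc 0 a)) (r : ℝ) (hr : r ∈ Ioc 0 a) :
    HasDerivWithinAt w (v r) (Iic r) r ∧
    HasDerivWithinAt v (-(k r * v r) - lam * (|w r| ^ (p - 1) * w r - w r)) (Iic r) r := by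
  rcases hr.2.lt_or_eq with hlt | rfl
  · exact ⟨(h.hw r ⟨hr.1, hlt⟩).hasDerivWithinAt, (h.hv r ⟨hr.1, hlt⟩).hasDerivWithinAt⟩
  have hmem : Ioo 0 r ∈ 𝓝[<] r := Ioo_mem_nhdsLT hr.1
  constructor
  · refine hasDerivWithinAt_Iic_of_tendsto_deriv (s := Ioo 0 r)
      (fun x hx => (h.hw x hx).differentiableAt.differentiableWithinAt) h.cw.continuousWithinAt hmem ?_
    refine ((h.cv.tendsto r).mono_left nhdsWithin_le_nhds).congr' ?_
    filter_upwards [hmem] with x hx using (h.hw x hx).deriv.symm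
  · refine hasDerivWithinAt_Iic_of_tendsto_deriv (s := Ioo 0 r)
      (fun x hx => (h.hv x hx).differentiableAt.differentiableWithinAt) h.cv.continuousWithinAt hmem ?_
    have hkt : Tendsto k (𝓝[<] r) (𝓝 (k r)) :=
      (hk r hr).mono_left (by rw [← nhdsWithin_Ioo_eq_nhdsLT hr.1]; exact nhdsWithin_mono _ Ioo_subset_Ioc_self)
    refine (((hkt.mul ((h.cv.tendsto r).mono_left nhdsWithin_le_nhds)).neg).sub
      (((h.cf hp).tendsto r).mono_left nhdsWithin_le_nhds)).congr' ?_
    filter_upwards [hmem] with x hx using (h.hv x hx).deriv.symm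

lemma aux_uniq {k : ℝ → ℝ} {lam p a : ℝ} {w v w2 v2 : ℝ → ℝ} (h : AuxSol k lam p a w v)
    (h2 : AuxSol k lam p a w2 v2) (hp : 1 < p)
    (hk : ContinuousOn k (Ioc 0 a)) (r0 : ℝ) (hr0 : r0 ∈ Ioc 0 a) (e1 : w r0 = w2 r0)
    (e2 : v r0 = v2 r0) : ∀ r ∈ Icc 0 r0, w r = w2 r ∧ v r = v2 r := by
  have main : ∀ r ∈ Ioc 0 r0, w r = w2 r ∧ v r = v2 r := by
    intro ε hε
    have hsub : Icc ε r0 ⊆ Ioc 0 a := fun x hx => ⟨hε.1.trans_le hx.1, hx.2.trans hr0.2⟩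
    obtain ⟨M1, hM1⟩ := (isCompact_Icc (a := ε) (b := r0)).exists_bound_of_continuousOn h.cw.continuousOn
    obtain ⟨M2, hM2⟩ := (isCompact_Icc (a := ε) (b := r0)).exists_bound_of_continuousOn h2.cw.continuousOn
    obtain ⟨K, hK⟩ := (isCompact_Icc (a := ε) (b := r0)).exists_bound_of_continuousOn (hk.mono hsub)
    obtain ⟨L, hL0, hL⟩ := aux_lip p (max M1 M2) hp
    have hK0 : 0 ≤ K := (norm_nonneg _).trans (hK r0 ⟨hε.2, le_rfl⟩)
    have hC : 0 ≤ 1 + K + |lam| * (L + 1) := by positivity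
    have := ODE_solution_unique_of_mem_Icc_left (a := ε) (b := r0) (K := ⟨_, hC⟩)
      (v := fun t (z : ℝ × ℝ) => (z.2, -(k t * z.2) - lam * (|z.1| ^ (p - 1) * z.1 - z.1)))
      (s := fun _ => {z : ℝ × ℝ | |z.1| ≤ max M1 M2})
      (f := fun t => (w t, v t)) (g := fun t => (w2 t, v2 t)) ?_
      (h.cw.prodMk h.cv).continuousOn
      (fun t ht => ((h.left hp hk t (hsub ⟨ht.1.le, ht.2⟩)).1.prodMk (h.left hp hk t (hsub ⟨ht.1.le, ht.2⟩)).2))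
      (fun t ht => (hM1 t ⟨ht.1.le, ht.2⟩).trans (le_max_left _ _))
      (h2.cw.prodMk h2.cv).continuousOn
      (fun t ht => ((h2.left hp hk t (hsub ⟨ht.1.le, ht.2⟩)).1.prodMk (h2.left hp hk t (hsub ⟨ht.1.le, ht.2⟩)).2))
      (fun t ht => (hM2 t ⟨ht.1.le, ht.2⟩).trans (le_max_right _ _))
      (by simp [e1, e2])
    · have := this (⟨le_rfl, hε.2⟩ : ε ∈ Icc ε r0)
      simpa using this
    · intro t ht
      refine LipschitzOnWith.of_dist_le_mul fun x hx y hy => ?_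
      have hKt := hK t ⟨ht.1.le, ht.2⟩
      have hf := hL x.1 y.1 hx hy
      rw [Real.norm_eq_abs] at hKt
      have d1 : |x.1 - y.1| ≤ dist x y := by rw [Prod.dist_eq, Real.dist_eq]; exact le_max_left _ _
      have d2 : |x.2 - y.2| ≤ dist x y := by rw [Prod.dist_eq, Real.dist_eq, Real.dist_eq]; exact le_max_right _ _
      have d0 : 0 ≤ dist x y := dist_nonneg
      change _ ≤ (1 + K + |lam| * (L + 1)) * dist x y
      have hl := abs_nonneg lam
      have m1 : 0 ≤ K * dist x y := by positivity
      have m2 : 0 ≤ |lam| * (L + 1) * dist x y := by positivity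
      rw [Prod.dist_eq (x := (_, _))]
      refine max_le ?_ ?_
      · simp only [Real.dist_eq]
        linarith
      · simp only [Real.dist_eq]
        set A := |x.1| ^ (p-1) * x.1
        set B := |y.1| ^ (p-1) * y.1
        calc _ = |(-(k t * (x.2 - y.2)) - lam * (A - B)) + lam * (x.1 - y.1)| := by congr 1; ring
          _ ≤ |-(k t * (x.2 - y.2)) - lam * (A - B)| + |lam * (x.1 - y.1)| := abs_add_le _ _
          _ ≤ (|-(k t * (x.2 - y.2))| + |lam * (A - B)|) + |lam * (x.1 - y.1)| := by
            gcongr; exact abs_sub _ _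
          _ = |k t| * |x.2 - y.2| + |lam| * |A - B| + |lam| * |x.1 - y.1| := by
            rw [abs_neg, abs_mul, abs_mul, abs_mul]
          _ ≤ K * dist x y + |lam| * (L * dist x y) + |lam| * dist x y := by
            have : |A - B| ≤ L * dist x y := hf.trans (by gcongr)
            gcongr
          _ ≤ _ := by linarith
  have cl : Icc 0 r0 ⊆ {r | w r = w2 r ∧ v r = v2 r} := by
    rw [← closure_Ioc hr0.1.ne]
    exact closure_minimal main ((isClosed_eq h.cw h2.cw).inter (isClosed_eq h.cv h2.cv))
  exact cl

lemma AuxSol.neg {k : ℝ → ℝ} {lam p a : ℝ} {w v : ℝ → ℝ} (h : AuxSol k lam p a w v) :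
    AuxSol k lam p a (fun r => - w r) (fun r => - v r) where
  cw := h.cw.neg
  cv := h.cv.neg
  hw r hr := (h.hw r hr).neg
  hv r hr := by
    refine (h.hv r hr).neg.congr_deriv ?_
    rw [abs_neg]; ring

lemma auxSol_zero (k : ℝ → ℝ) (lam p a : ℝ) : AuxSol k lam p a (fun _ => 0) (fun _ => 0) where
  cw := continuous_const
  cv := continuous_const
  hw r hr := hasDerivAt_const _ _
  hv r hr := by simpa using hasDerivAt_const r (0:ℝ)

lemma auxSol_one (k : ℝ → ℝ) (lam p a : ℝ) : AuxSol k lam p a (fun _ => 1) (fun _ => 0) where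
  cw := continuous_const
  cv := continuous_const
  hw r hr := hasDerivAt_const _ _
  hv r hr := by simpa using hasDerivAt_const r (0:ℝ)

/-- energy: after a critical point in `(0,1)` the solution stays positive -/
lemma aux_energy {k : ℝ → ℝ} {lam p a : ℝ} {w v : ℝ → ℝ} (h : AuxSol k lam p a w v) (hp : 1 < p)
    (hlam : 0 < lam) (hk : ∀ r ∈ Ioo 0 a, 0 < k r) (r1 : ℝ) (hr1 : r1 ∈ Ioc 0 a) (hv1 : v r1 = 0)
    (hw1 : 0 < w r1) (hw1' : w r1 < 1) : 0 < w a := by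
  let E : ℝ → ℝ := fun r => v r ^ 2 / 2 + lam * (|w r| ^ (p+1) / (p+1) - w r ^ 2 / 2)
  have hE : ∀ r ∈ Ioo 0 a, HasDerivAt E (-(k r * v r ^ 2)) r := by
    intro r hr
    have a1 := h.hw r hr
    have a2 := h.hv r hr
    have a3 := (hasDerivAt_abs_rpow (w r) (by linarith : 1 < p + 1)).comp r a1
    have a4 := ((a2.pow 2).div_const 2).add (((a3.div_const (p+1)).sub ((a1.pow 2).div_const 2)).const_mul lam)
    refine a4.congr_deriv ?_
    rw [show p + 1 - 2 = p - 1 by ring]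
    have : p + 1 ≠ 0 := by linarith
    field_simp
    ring
  have cE : Continuous E := by
    have c1 := h.cw
    have c2 := h.cv
    have c3 : Continuous fun r => |w r| ^ (p+1) :=
      (continuous_abs.comp c1).rpow_const (fun x => Or.inr (by linarith))
    fun_prop
  have anti : AntitoneOn E (Icc r1 a) := by
    refine antitoneOn_of_deriv_nonpos (convex_Icc _ _) cE.continuousOn ?_ ?_
    · rw [interior_Icc]
      exact fun x hx => (hE x ⟨hr1.1.trans hx.1, hx.2⟩).differentiableAt.differentiableWithinAt
    · rw [interior_Icc]
      intro x hx
      have hx' : x ∈ Ioo 0 a := ⟨hr1.1.trans hx.1, hx.2⟩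
      rw [(hE x hx').deriv]
      have := mul_nonneg (hk x hx').le (sq_nonneg (v x))
      linarith
  have E1 : E r1 < 0 := by
    have b1 : |w r1| ^ (p+1) < w r1 ^ 2 := by
      rw [abs_of_pos hw1, ← Real.rpow_two]
      exact Real.rpow_lt_rpow_of_exponent_gt hw1 hw1' (by linarith)
    have b2 : |w r1| ^ (p+1) / (p+1) ≤ |w r1| ^ (p+1) / 2 := by
      gcongr
      linarith
    have : |w r1| ^ (p+1) / (p+1) - w r1 ^ 2 / 2 < 0 := by linarith
    have := mul_neg_of_pos_of_neg hlam this
    simp only [E, hv1]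
    linarith
  have nz : ∀ r ∈ Icc r1 a, w r ≠ 0 := by
    intro r hr h0
    have := anti ⟨le_rfl, hr1.2⟩ hr hr.1
    have h3 : E r = v r ^ 2 / 2 := by
      simp only [E, h0]; rw [abs_zero, Real.zero_rpow (by linarith)]; ring
    nlinarith [sq_nonneg (v r)]
  by_contra hcon
  obtain ⟨r, hr, hr'⟩ := intermediate_value_Icc' hr1.2 h.cw.continuousOn ⟨not_lt.1 hcon, hw1.le⟩
  exact nz r hr hr'

lemma aux_const (s : Set ℝ) (hs : OrdConnected s) (h : ∀ x ∈ s, Real.sin x = 0) (x y : ℝ)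
    (hx : x ∈ s) (hy : y ∈ s) : x = y := by
  have key : ∀ x ∈ s, ∀ y ∈ s, ¬ x < y := by
    intro x hx y hy hlt
    have hp := Real.pi_pos
    have hδ : 0 < min (y - x) (Real.pi / 2) := lt_min (by linarith) (by linarith)
    have h1 := h _ (hs.out hx hy (⟨by linarith, by linarith [min_le_left (y-x) (Real.pi/2)]⟩ :
      x + min (y - x) (Real.pi / 2) ∈ Icc x y))
    have h2 : 0 < Real.sin (min (y - x) (Real.pi / 2)) :=
      Real.sin_pos_of_pos_of_lt_pi hδ (by linarith [min_le_right (y-x) (Real.pi/2)])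
    have h3 := h x hx
    have h4 := Real.sin_sq_add_cos_sq x
    rw [Real.sin_add, h3, zero_mul, zero_add] at h1
    rcases mul_eq_zero.1 h1 with h5 | h5
    · rw [h3, h5] at h4; norm_num at h4
    · linarith
  exact le_antisymm (not_lt.1 (key y hy x hx)) (not_lt.1 (key x hx y hy))

lemma aux_const' (φ : ℝ → ℝ) (hφ : Continuous φ) (h : ∀ x, Real.sin (φ x) = 0) (x y : ℝ) :
    φ x = φ y :=
  aux_const (range φ) (isPreconnected_range hφ).ordConnected (by rintro _ ⟨x, rfl⟩; exact h x) _ _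
    ⟨x, rfl⟩ ⟨y, rfl⟩

lemma aux_f_pos (p w : ℝ) (hp : 1 < p) (hw : 1 < w) : 0 < |w| ^ (p-1) * w - w := by
  have : 1 < |w| ^ (p-1) := by
    rw [abs_of_pos (by linarith)]; exact Real.one_lt_rpow hw (by linarith)
  nlinarith

lemma aux_f_neg (p w : ℝ) (hp : 1 < p) (hw : 0 < w) (hw' : w < 1) : |w| ^ (p-1) * w - w < 0 := by
  have : |w| ^ (p-1) < 1 := by
    rw [abs_of_pos (by linarith)]; exact Real.rpow_lt_one hw.le hw' (by linarith)
  nlinarith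

/-- sign near a zero with nonzero derivative -/
lemma aux_right_neg (f : ℝ → ℝ) (f' x : ℝ) (h : HasDerivAt f f' x) (h0 : f x = 0) (hf : f' < 0) :
    (∀ᶠ y in 𝓝[>] x, f y < 0) ∧ (∀ᶠ y in 𝓝[<] x, 0 < f y) := by
  have h1 := (hasDerivAt_iff_tendsto_slope.1 h).eventually_lt_const hf
  constructor
  · have h2 : ∀ᶠ y in 𝓝[>] x, slope f x y < 0 := h1.filter_mono (nhdsWithin_mono _ (fun y hy => ne_of_gt hy))
    filter_upwards [h2, self_mem_nhdsWithin] with y hy hy'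
    rw [slope_def_field, h0, sub_zero] at hy
    have : 0 < y - x := sub_pos.2 hy'
    by_contra hc
    exact absurd hy (not_lt.2 (div_nonneg (not_lt.1 hc) this.le))
  · have h2 : ∀ᶠ y in 𝓝[<] x, slope f x y < 0 := h1.filter_mono (nhdsWithin_mono _ (fun y hy => ne_of_lt hy))
    filter_upwards [h2, self_mem_nhdsWithin] with y hy hy'
    rw [slope_def_field, h0, sub_zero] at hy
    have : y - x < 0 := sub_neg.2 hy'
    by_contra hc
    exact absurd hy (not_lt.2 (div_nonneg_of_nonpos (not_lt.1 hc) this.le))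

lemma aux_left_pos (f : ℝ → ℝ) (f' x : ℝ) (h : HasDerivWithinAt f f' (Iic x) x) (h0 : f x = 0) (hf : f' < 0) :
    (∀ᶠ y in 𝓝[<] x, 0 < f y) := by
  have h1 := (hasDerivWithinAt_iff_tendsto_slope.1 h).eventually_lt_const hf
  have h2 : ∀ᶠ y in 𝓝[<] x, slope f x y < 0 :=
    h1.filter_mono (nhdsWithin_mono _ (fun y (hy : y < x) => (⟨le_of_lt hy, ne_of_lt hy⟩ : y ∈ Iic x \ {x})))
  filter_upwards [h2, self_mem_nhdsWithin] with y hy hy'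
  rw [slope_def_field, h0, sub_zero] at hy
  have : y - x < 0 := sub_neg.2 hy'
  by_contra hc
  exact absurd hy (not_lt.2 (div_nonneg_of_nonpos (not_lt.1 hc) this.le))

/-- the phase angle of one solution which starts and ends at the same angle stays in a half turn -/
lemma aux_pos {k : ℝ → ℝ} {lam p a : ℝ} {w v φ ρ : ℝ → ℝ} (h : AuxSol k lam p a w v) (hp : 1 < p)
    (ha : 0 < a) (hk : ContinuousOn k (Ioc 0 a)) (hφ : Continuous φ)
    (hρ : ∀ r ∈ Icc 0 a, 0 < ρ r ∧ w r = ρ r * Real.cos (φ r) ∧ v r = ρ r * Real.sin (φ r))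
    (c : ℝ) (h0 : φ 0 = c) (h1 : φ a = c) (hc : Real.cos c = 1) (hs : Real.sin c = 0) :
    ∀ r ∈ Icc 0 a, 0 < w r := by
  have hpi := Real.pi_pos
  have wpos : ∀ r ∈ Icc 0 a, c - Real.pi/2 < φ r → φ r < c + Real.pi/2 → 0 < w r := by
    intro r hr h1 h2
    rw [(hρ r hr).2.1]
    refine mul_pos (hρ r hr).1 ?_
    have : Real.cos (φ r) = Real.cos (φ r - c) := by
      rw [Real.cos_sub, hc, hs]; ring
    rw [this]
    exact Real.cos_pos_of_mem_Ioo ⟨by linarith, by linarith⟩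
  have up : ∀ r ∈ Icc 0 a, φ r < c + Real.pi/2 := by
    intro r hr
    by_contra hcon
    push Not at hcon
    have hcomp : IsCompact (Icc 0 a ∩ {r | φ r = c + Real.pi/2}) :=
      isCompact_Icc.inter_right (isClosed_eq hφ continuous_const)
    obtain ⟨r', hr', hr''⟩ := intermediate_value_Icc hr.1 hφ.continuousOn
      (⟨by linarith, hcon⟩ : c + Real.pi/2 ∈ Icc (φ 0) (φ r))
    obtain ⟨s, ⟨hsI, hsφ⟩, hsl⟩ := hcomp.exists_isLeast ⟨r', ⟨hr'.1, hr'.2.trans hr.2⟩, hr''⟩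
    have hsφ : φ s = c + Real.pi/2 := hsφ
    have hs0 : 0 < s := by
      rcases hsI.1.eq_or_lt with e | e
      · rw [← e, h0] at hsφ; linarith
      · exact e
    have hw0 : w s = 0 := by
      rw [(hρ s hsI).2.1, hsφ, Real.cos_add_pi_div_two, hs]; simp
    have hv0 : 0 < v s := by
      rw [(hρ s hsI).2.2, hsφ, Real.sin_add_pi_div_two, hc]; simpa using (hρ s hsI).1
    have e1 := aux_left_pos (fun r => - w r) (- v s) s (h.left hp hk s ⟨hs0, hsI.2⟩).1.neg (by simp [hw0])
      (by linarith)
    have e2 : ∀ᶠ y in 𝓝[<] s, c - Real.pi/2 < φ y :=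
      (hφ.continuousAt.eventually (lt_mem_nhds (by linarith))).filter_mono nhdsWithin_le_nhds
    have e3 : ∀ᶠ y in 𝓝[<] s, y ∈ Ioo 0 s := Ioo_mem_nhdsLT hs0
    obtain ⟨y, y1, y2, y3⟩ := (e1.and (e2.and e3)).exists
    have hyI : y ∈ Icc 0 a := ⟨y3.1.le, y3.2.le.trans hsI.2⟩
    have : φ y < c + Real.pi/2 := by
      by_contra hcon
      push Not at hcon
      obtain ⟨z, hz, hz'⟩ := intermediate_value_Icc y3.1.le hφ.continuousOn
        (⟨by linarith, hcon⟩ : c + Real.pi/2 ∈ Icc (φ 0) (φ y))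
      have := hsl ⟨⟨hz.1, hz.2.trans hyI.2⟩, hz'⟩
      linarith [hz.2, y3.2]
    have := wpos y hyI y2 this
    simp at y1
    linarith
  have lo : ∀ r ∈ Icc 0 a, c - Real.pi/2 < φ r := by
    intro r hr
    by_contra hcon
    push Not at hcon
    have hcomp : IsCompact (Icc 0 a ∩ {r | φ r = c - Real.pi/2}) :=
      isCompact_Icc.inter_right (isClosed_eq hφ continuous_const)
    obtain ⟨r', hr', hr''⟩ := intermediate_value_Icc hr.2 hφ.continuousOn
      (⟨hcon, by linarith⟩ : c - Real.pi/2 ∈ Icc (φ r) (φ a))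
    obtain ⟨s, ⟨hsI, hsφ⟩, hsl⟩ := hcomp.exists_isGreatest ⟨r', ⟨hr.1.trans hr'.1, hr'.2⟩, hr''⟩
    have hsφ : φ s = c - Real.pi/2 := hsφ
    have hs0 : 0 < s := by
      rcases hsI.1.eq_or_lt with e | e
      · rw [← e, h0] at hsφ; linarith
      · exact e
    have hsa : s < a := by
      rcases hsI.2.eq_or_lt with e | e
      · rw [e, h1] at hsφ; linarith
      · exact e
    have hw0 : w s = 0 := by
      rw [(hρ s hsI).2.1, hsφ, Real.cos_sub_pi_div_two, hs]; simp
    have hv0 : v s < 0 := by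
      rw [(hρ s hsI).2.2, hsφ, Real.sin_sub_pi_div_two, hc]; simpa using (hρ s hsI).1
    have e1 := (aux_right_neg w (v s) s (h.hw s ⟨hs0, hsa⟩) hw0 hv0).1
    have e3 : ∀ᶠ y in 𝓝[>] s, y ∈ Ioo s a := Ioo_mem_nhdsGT hsa
    obtain ⟨y, y1, y3⟩ := (e1.and e3).exists
    have hyI : y ∈ Icc 0 a := ⟨hsI.1.trans y3.1.le, y3.2.le⟩
    have : c - Real.pi/2 < φ y := by
      by_contra hcon
      push Not at hcon
      obtain ⟨z, hz, hz'⟩ := intermediate_value_Icc y3.2.le hφ.continuousOn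
        (⟨hcon, by linarith⟩ : c - Real.pi/2 ∈ Icc (φ y) (φ a))
      have := hsl ⟨⟨hyI.1.trans hz.1, hz.2⟩, hz'⟩
      linarith [hz.1, y3.1]
    have := wpos y hyI this (up y hyI)
    linarith
  exact fun r hr => wpos r hr (lo r hr) (up r hr)

lemma aux_crit {k : ℝ → ℝ} {lam p a : ℝ} {w v : ℝ → ℝ} (h : AuxSol k lam p a w v) (hp : 1 < p)
    (ha : 0 < a) (hlam : 0 < lam) (hk : ContinuousOn k (Ioc 0 a)) (hkpos : ∀ r ∈ Ioo 0 a, 0 < k r)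
    (hw0 : 1 < w 0) (hv0 : v 0 = 0) (hwa : 1 < w a) (hva : v a = 0) :
    ∃ r ∈ Ioo 0 a, v r = 0 ∧ w r ≤ 1 := by
  by_contra hcon
  push Not at hcon
  have dneg : ∀ w : ℝ, 1 < w → lam * (|w| ^ (p - 1) * w - w) > 0 :=
    fun w hw => mul_pos hlam (aux_f_pos p w hp hw)
  have e1 := aux_left_pos v _ a (h.left hp hk a ⟨ha, le_rfl⟩).2 hva
    (by rw [hva]; have := dneg _ hwa; linarith)
  have e3 : ∀ᶠ y in 𝓝[<] a, y ∈ Ioo 0 a := Ioo_mem_nhdsLT ha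
  obtain ⟨r2, hr2v, hr2⟩ := (e1.and e3).exists
  have hcomp : IsCompact (Icc 0 r2 ∩ {r | v r = 0}) :=
    isCompact_Icc.inter_right (isClosed_eq h.cv continuous_const)
  obtain ⟨s, ⟨hsI, hsv⟩, hsl⟩ := hcomp.exists_isGreatest ⟨0, ⟨le_rfl, hr2.1.le⟩, hv0⟩
  have hsv : v s = 0 := hsv
  have hsr : s < r2 := by
    rcases hsI.2.eq_or_lt with e | e
    · rw [e] at hsv; linarith
    · exact e
  have vpos : ∀ y ∈ Ioc s r2, 0 < v y := by
    intro y hy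
    by_contra hc
    push Not at hc
    obtain ⟨z, hz, hz'⟩ := intermediate_value_Icc hy.2 h.cv.continuousOn
        (⟨hc, hr2v.le⟩ : 0 ∈ Icc (v y) (v r2))
    have := hsl ⟨⟨(hsI.1.trans hy.1.le).trans hz.1, hz.2⟩, hz'⟩
    linarith [hz.1, hy.1]
  rcases hsI.1.eq_or_lt with e | e
  · subst e
    have wmono : MonotoneOn w (Icc 0 r2) := by
      refine monotoneOn_of_deriv_nonneg (convex_Icc _ _) h.cw.continuousOn ?_ ?_
      · rw [interior_Icc]
        exact fun x hx => (h.hw x ⟨hx.1, hx.2.trans hr2.2⟩).differentiableAt.differentiableWithinAt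
      · rw [interior_Icc]
        intro x hx
        rw [(h.hw x ⟨hx.1, hx.2.trans hr2.2⟩).deriv]
        exact (vpos x ⟨hx.1, hx.2.le⟩).le
    have vanti : StrictAntiOn v (Icc 0 r2) := by
      refine strictAntiOn_of_deriv_neg (convex_Icc _ _) h.cv.continuousOn ?_
      rw [interior_Icc]
      intro x hx
      have hx' : x ∈ Ioo 0 a := ⟨hx.1, hx.2.trans hr2.2⟩
      rw [(h.hv x hx').deriv]
      have m1 := mul_pos (hkpos x hx') (vpos x ⟨hx.1, hx.2.le⟩)
      have m2 := dneg (w x) (hw0.trans_le (wmono ⟨le_rfl, hr2.1.le⟩ ⟨hx.1.le, hx.2.le⟩ hx.1.le))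
      linarith
    have := vanti ⟨le_rfl, hr2.1.le⟩ ⟨hr2.1.le, le_rfl⟩ hr2.1
    linarith
  · have hsa : s ∈ Ioo 0 a := ⟨e, hsr.trans hr2.2⟩
    have e1 := (aux_right_neg v _ s (h.hv s hsa) hsv
      (by rw [hsv]; have := dneg _ (hcon s hsa hsv); linarith)).1
    have e3 : ∀ᶠ y in 𝓝[>] s, y ∈ Ioo s r2 := Ioo_mem_nhdsGT hsr
    obtain ⟨y, y1, y3⟩ := (e1.and e3).exists
    have := vpos y ⟨y3.1, y3.2.le⟩
    linarith

structure AuxFam (k : ℝ → ℝ) (lam p a : ℝ) (W V : ℝ → ℝ → ℝ) (θ R : ℝ → ℝ) : Prop where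
  hp : 1 < p
  ha : 0 < a
  hlam : 0 < lam
  hk : ContinuousOn k (Ioc 0 a)
  hkpos : ∀ r ∈ Ioo 0 a, 0 < k r
  sol : ∀ d, AuxSol k lam p a (W d) (V d)
  cW : Continuous fun q : ℝ × ℝ => W q.1 q.2
  cV : Continuous fun q : ℝ × ℝ => V q.1 q.2
  W0 : ∀ d, W d 0 = d
  V0 : ∀ d, V d 0 = 0
  cθ : Continuous θ
  θ1 : θ 1 = 0
  hR : ∀ d, R d = Real.sqrt (W d a ^ 2 + V d a ^ 2)
  hW : ∀ d, 1 ≤ d → W d a = R d * Real.cos (θ d)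
  hV : ∀ d, 1 ≤ d → V d a = R d * Real.sin (θ d)
  tend : Tendsto θ atTop atBot
  one : ∃ d, 1 ≤ d ∧ θ d = 0 ∧ R d = 1

namespace AuxFam
variable {k : ℝ → ℝ} {lam p a : ℝ} {W V : ℝ → ℝ → ℝ} {θ R : ℝ → ℝ}

lemma nz (F : AuxFam k lam p a W V θ R) (d : ℝ) (hd : 1 ≤ d) (r : ℝ) (hr : r ∈ Icc 0 a) :
    ¬ (W d r = 0 ∧ V d r = 0) := by
  rintro ⟨h1, h2⟩
  rcases hr.1.eq_or_lt with e | e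
  · rw [← e, F.W0] at h1; linarith
  · have := (aux_uniq (F.sol d) (auxSol_zero k lam p a) F.hp F.hk r ⟨e, hr.2⟩ h1 h2 0 ⟨le_rfl, e.le⟩).1
    rw [F.W0] at this
    linarith

lemma Rpos (F : AuxFam k lam p a W V θ R) (d : ℝ) (hd : 1 ≤ d) : 0 < R d := by
  rcases (Real.sqrt_nonneg (W d a ^ 2 + V d a ^ 2)).eq_or_lt with e | e
  · exfalso
    rw [← F.hR] at e
    exact F.nz d hd a ⟨F.ha.le, le_rfl⟩ ⟨by rw [F.hW d hd, ← e, zero_mul], by rw [F.hV d hd, ← e, zero_mul]⟩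
  · rwa [F.hR]

lemma isone (F : AuxFam k lam p a W V θ R) (d : ℝ) (r : ℝ) (hr : r ∈ Ioc 0 a)
    (h1 : W d r = 1) (h2 : V d r = 0) : d = 1 := by
  have := (aux_uniq (F.sol d) (auxSol_one k lam p a) F.hp F.hk r hr h1 h2 0 ⟨le_rfl, hr.1.le⟩).1
  rwa [F.W0] at this

lemma one' (F : AuxFam k lam p a W V θ R) : ∀ r ∈ Icc 0 a, W 1 r = 1 ∧ V 1 r = 0 := by
  obtain ⟨d, hd, h1, h2⟩ := F.one
  have e1 : W d a = 1 := by rw [F.hW d hd, h1, h2]; simp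
  have e2 : V d a = 0 := by rw [F.hV d hd, h1, h2]; simp
  have := F.isone d a ⟨F.ha, le_rfl⟩ e1 e2
  subst this
  exact aux_uniq (F.sol _) (auxSol_one k lam p a) F.hp F.hk a ⟨F.ha, le_rfl⟩ e1 e2

lemma pos0 (F : AuxFam k lam p a W V θ R) (d0 : ℝ) (hd : 1 ≤ d0) (h0 : θ d0 = 0) :
    ∀ r ∈ Icc 0 a, 0 < W d0 r := by
  have cW := F.cW
  have cV := F.cV
  have cl : ∀ r : ℝ, max 0 (min r a) ∈ Icc 0 a := fun r =>
    ⟨le_max_left _ _, max_le F.ha.le (min_le_right _ _)⟩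
  have cl' : ∀ r ∈ Icc 0 a, max 0 (min r a) = r := fun r hr => by
    rw [min_eq_left hr.2, max_eq_right hr.1]
  obtain ⟨Θ, ρ, hΘ, hρ⟩ := aux_lift (fun z => W (max 1 z.1) (max 0 (min z.2 a)))
    (fun z => V (max 1 z.1) (max 0 (min z.2 a)))
    (cW.comp (by fun_prop : Continuous fun z : ℝ × ℝ => (max 1 z.1, max 0 (min z.2 a))))
    (cV.comp (by fun_prop : Continuous fun z : ℝ × ℝ => (max 1 z.1, max 0 (min z.2 a))))
    (fun z hz => F.nz _ (le_max_left _ _) _ (cl _) hz)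
  have hρ' : ∀ d r, 1 ≤ d → r ∈ Icc 0 a → 0 < ρ (d,r) ∧ W d r = ρ (d,r) * Real.cos (Θ (d,r)) ∧
      V d r = ρ (d,r) * Real.sin (Θ (d,r)) := by
    intro d r hd hr
    have := hρ (d,r)
    simpa only [max_eq_right hd, cl' r hr] using this
  have i0 : (0:ℝ) ∈ Icc 0 a := ⟨le_rfl, F.ha.le⟩
  have ia : a ∈ Icc 0 a := ⟨F.ha.le, le_rfl⟩
  have z : ∀ d r, 1 ≤ d → r ∈ Icc 0 a → V d r = 0 → Real.sin (Θ (d,r)) = 0 := by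
    intro d r hd hr h
    obtain ⟨k1, -, k3⟩ := hρ' d r hd hr
    rw [h] at k3
    exact (mul_eq_zero.1 k3.symm).resolve_left k1.ne'
  have s1 := aux_const' (fun d => Θ (max 1 d, 0)) (by fun_prop)
    (fun d => z _ _ (le_max_left _ _) i0 (F.V0 _)) d0 1
  have s2 := aux_const' (fun r => Θ (1, max 0 (min r a))) (by fun_prop)
    (fun r => z _ _ le_rfl (cl r) (F.one' _ (cl r)).2) a 0
  have cθ := F.cθ
  have s3 := aux_const' (fun d => Θ (max 1 d, a) - θ (max 1 d)) (by fun_prop) (fun d => by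
    have hm : 1 ≤ max 1 d := le_max_left _ _
    obtain ⟨k1, k2, k3⟩ := hρ' (max 1 d) a hm ia
    rw [F.hW _ hm] at k2
    rw [F.hV _ hm] at k3
    have : ρ (max 1 d, a) * Real.sin (Θ (max 1 d, a) - θ (max 1 d)) = 0 := by
      rw [Real.sin_sub, mul_sub, ← mul_assoc, ← mul_assoc, ← k2, ← k3]; ring
    exact (mul_eq_zero.1 this).resolve_left k1.ne') d0 1
  simp only [max_eq_right hd, max_self, cl' 0 i0, cl' a ia, F.θ1, h0, sub_zero] at s1 s2 s3
  have hsin := z 1 0 le_rfl i0 (F.V0 1)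
  have hcos : Real.cos (Θ (1,0)) = 1 := by
    obtain ⟨k1, k2, k3⟩ := hρ' 1 0 le_rfl i0
    rw [F.W0] at k2
    have h4 := Real.sin_sq_add_cos_sq (Θ (1,0))
    rw [hsin] at h4
    have : 0 < ρ (1,0) * Real.cos (Θ (1,0)) := by linarith
    have := (mul_pos_iff_of_pos_left k1).1 this
    nlinarith
  exact aux_pos (φ := fun r => Θ (d0, r)) (ρ := fun r => ρ (d0, r)) (F.sol d0) F.hp F.ha F.hk (by fun_prop)
    (fun r hr => hρ' d0 r hd hr) (Θ (1,0)) s1 (s3.trans s2) hcos hsin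

lemma x0 (F : AuxFam k lam p a W V θ R) (d0 : ℝ) (hd : 1 ≤ d0) (h0 : θ d0 = 0)
    (hafter : ∀ d > d0, θ d < 0) : R d0 ≤ 1 := by
  by_contra hcon
  push Not at hcon
  have hpi := Real.pi_pos
  have ia : a ∈ Icc 0 a := ⟨F.ha.le, le_rfl⟩
  have eW : 1 < W d0 a := by rw [F.hW d0 hd, h0]; simpa using hcon
  have eV : V d0 a = 0 := by rw [F.hV d0 hd, h0]; simp
  have hd1 : 1 < d0 := by
    rcases hd.eq_or_lt with e | e
    · rw [← e, (F.one' a ia).1] at eW; linarith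
    · exact e
  let S : Set ℝ := {d | d0 ≤ d ∧ (-(Real.pi/2) ≤ θ d ∧ θ d ≤ 0) ∧ ∃ r ∈ Icc 0 a, V d r = 0 ∧ 0 ≤ W d r ∧ W d r ≤ 1}
  have hS0 : d0 ∈ S := by
    obtain ⟨r, hr, hr1, hr2⟩ := aux_crit (F.sol d0) F.hp F.ha F.hlam F.hk F.hkpos (by rw [F.W0]; exact hd1)
      (F.V0 _) eW eV
    have hrI : r ∈ Icc 0 a := ⟨hr.1.le, hr.2.le⟩
    exact ⟨le_rfl, ⟨by linarith, by linarith⟩, r, hrI, hr1, (F.pos0 d0 hd h0 r hrI).le, hr2⟩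
  have hS : ∀ d ∈ S, -(Real.pi/2) < θ d ∧ ∃ r ∈ Ioo 0 a, V d r = 0 ∧ 0 < W d r ∧ W d r < 1 := by
    rintro d ⟨hdd, ⟨t1, t2⟩, r, hr, r1, r2, r3⟩
    have hd1' : 1 < d := hd1.trans_le hdd
    have hr0 : 0 < r := by
      rcases hr.1.eq_or_lt with e | e
      · rw [← e, F.W0] at r3; linarith
      · exact e
    have r2' : 0 < W d r := lt_of_le_of_ne r2 fun e => F.nz d hd1'.le r hr ⟨e.symm, r1⟩
    have r3' : W d r < 1 := lt_of_le_of_ne r3 fun e => hd1'.ne' (F.isone d r ⟨hr0, hr.2⟩ e r1)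
    have hpos := aux_energy (F.sol d) F.hp F.hlam F.hkpos r ⟨hr0, hr.2⟩ r1 r2' r3'
    rw [F.hW d hd1'.le] at hpos
    have hcos := (mul_pos_iff_of_pos_left (F.Rpos d hd1'.le)).1 hpos
    have t1' : -(Real.pi/2) < θ d := by
      refine lt_of_le_of_ne t1 fun e => ?_
      rw [← e, Real.cos_neg, Real.cos_pi_div_two] at hcos
      exact lt_irrefl _ hcos
    refine ⟨t1', r, ⟨hr0, lt_of_le_of_ne hr.2 ?_⟩, r1, r2', r3'⟩
    rintro rfl
    rw [F.hV d hd1'.le] at r1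
    have hsin := (mul_eq_zero.1 r1).resolve_left (F.Rpos d hd1'.le).ne'
    have ht := (Real.sin_eq_zero_iff_of_lt_of_lt (by linarith) (by linarith)).1 hsin
    rcases hdd.eq_or_lt with e | e
    · rw [← e] at r3; linarith
    · linarith [hafter d e]
  have cW := F.cW
  have cV := F.cV
  have cθ := F.cθ
  have sub : ∀ b, Icc d0 b ⊆ S := by
    intro b
    refine IsClosed.Icc_subset_of_forall_exists_gt ?_ hS0 ?_
    · have hcl : IsClosed {z : ℝ × ℝ | (-(Real.pi/2) ≤ θ z.1 ∧ θ z.1 ≤ 0) ∧ V z.1 z.2 = 0 ∧ 0 ≤ W z.1 z.2 ∧ W z.1 z.2 ≤ 1} := by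
        refine IsClosed.inter (IsClosed.inter ?_ ?_) (IsClosed.inter ?_ (IsClosed.inter ?_ ?_))
        · exact isClosed_le continuous_const (cθ.comp continuous_fst)
        · exact isClosed_le (cθ.comp continuous_fst) continuous_const
        · exact isClosed_eq cV continuous_const
        · exact isClosed_le continuous_const cW
        · exact isClosed_le cW continuous_const
      have hcomp := (((isCompact_Icc (a := d0) (b := b)).prod (isCompact_Icc (a := (0:ℝ)) (b := a))).inter_right
        hcl).image continuous_fst
      convert hcomp.isClosed using 1
      ext d
      constructor
      · rintro ⟨⟨h1, h2, r, hr, h3⟩, h4⟩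
        exact ⟨(d, r), ⟨⟨h4, hr⟩, h2, h3⟩, rfl⟩
      · rintro ⟨⟨d', r⟩, ⟨⟨h4, hr⟩, h2, h3⟩, rfl⟩
        exact ⟨⟨h4.1, h2, r, hr, h3⟩, h4⟩
    · rintro x ⟨hxS, hxI⟩ y hy
      obtain ⟨t1, r, hr, r1, r2, r3⟩ := hS x hxS
      have hopen : ∀ᶠ z : ℝ × ℝ in 𝓝 (x, r), 0 < W z.1 z.2 ∧ W z.1 z.2 < 1 :=
        (cW.continuousAt.eventually (lt_mem_nhds r2)).and (cW.continuousAt.eventually (gt_mem_nhds r3))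
      rw [nhds_prod_eq] at hopen
      obtain ⟨pa, hpa, pb, hpb, hab⟩ := eventually_prod_iff.1 hopen
      obtain ⟨δ, hδ, hδ'⟩ := Metric.eventually_nhds_iff.1 (hpb.and (Ioo_mem_nhds hr.1 hr.2))
      obtain ⟨g1, g2⟩ := aux_right_neg (fun s => - V x s) _ r ((F.sol x).hv r hr).neg (by simp [r1])
        (by
          rw [r1]
          have := mul_neg_of_pos_of_neg F.hlam (aux_f_neg p (W x r) F.hp r2 r3)
          linarith)
      obtain ⟨rp, q1, q2⟩ := (g1.and (Ioo_mem_nhdsGT (by linarith : r < r + δ))).exists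
      obtain ⟨rm, q3, q4⟩ := (g2.and (Ioo_mem_nhdsLT (by linarith : r - δ < r))).exists
      have k1 : ∀ᶠ d in 𝓝 x, 0 < V d rp :=
        (cV.comp (by fun_prop : Continuous fun d : ℝ => (d, rp))).continuousAt.eventually
          (lt_mem_nhds (by simpa using q1))
      have k2 : ∀ᶠ d in 𝓝 x, V d rm < 0 :=
        (cV.comp (by fun_prop : Continuous fun d : ℝ => (d, rm))).continuousAt.eventually
          (gt_mem_nhds (by simpa using q3))
      have k3 : ∀ᶠ d in 𝓝 x, -(Real.pi/2) < θ d := cθ.continuousAt.eventually (lt_mem_nhds t1)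
      have k4 := ((k1.and (k2.and (k3.and hpa))).filter_mono (nhdsWithin_le_nhds (s := Ioi x))).and
        (Ioc_mem_nhdsGT hy : Ioc x y ∈ 𝓝[>] x)
      obtain ⟨d, ⟨j1, j2, j3, j4⟩, j5⟩ := k4.exists
      obtain ⟨s, hs, hs'⟩ := intermediate_value_Icc (by linarith [q2.1, q4.2] : rm ≤ rp)
        (F.sol d).cv.continuousOn ⟨j2.le, j1.le⟩
      have hds : dist s r < δ := by
        rw [Real.dist_eq, abs_lt]
        constructor <;> linarith [hs.1, hs.2, q4.1, q2.2]
      obtain ⟨m1, m2⟩ := hδ' hds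
      have := hab j4 m1
      exact ⟨d, ⟨by linarith [hxI.1, j5.1], ⟨j3.le, (hafter d (by linarith [hxI.1, j5.1])).le⟩, s,
        ⟨m2.1.le, m2.2.le⟩, hs', this.1.le, this.2.le⟩, j5⟩
  obtain ⟨b, hb, hb'⟩ := ((F.tend.eventually_lt_atBot (-(Real.pi/2))).and (eventually_ge_atTop d0)).exists
  have := (sub b ⟨hb', le_rfl⟩).2.1.1
  linarith

lemma disj (F : AuxFam k lam p a W V θ R) (s t : ℝ) (hs : 1 ≤ s) (ht : 1 ≤ t) :
    ¬ (θ s = θ t + Real.pi ∧ R s = R t) := by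
  rintro ⟨h1, h2⟩
  have e1 : W s a = - W t a := by
    rw [F.hW s hs, F.hW t ht, h1, h2, Real.cos_add_pi]; ring
  have e2 : V s a = - V t a := by
    rw [F.hV s hs, F.hV t ht, h1, h2, Real.sin_add_pi]; ring
  have := (aux_uniq (F.sol s) (F.sol t).neg F.hp F.hk a ⟨F.ha, le_rfl⟩ e1 e2 0 ⟨le_rfl, F.ha.le⟩).1
  rw [F.W0, F.W0] at this
  linarith

lemma main (F : AuxFam k lam p a W V θ R) (d_ : ℕ → ℝ)
    (hd : ∀ i : ℕ, IsGreatest {d : ℝ | 1 ≤ d ∧ θ d = -(i : ℝ) * Real.pi} (d_ i))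
    (x : ℕ → ℝ) (hx : ∀ i, x i = R (d_ i)) :
    (StrictMono x ∨ StrictAnti x) ∧ x 0 ≤ 1 := by
  have hpi := Real.pi_pos
  have after : ∀ i : ℕ, ∀ d > d_ i, θ d < -(i : ℝ) * Real.pi := by
    intro i d hdd
    by_contra hcon
    push Not at hcon
    obtain ⟨b, hb, hb'⟩ := ((F.tend.eventually_lt_atBot (-(i : ℝ) * Real.pi)).and (eventually_ge_atTop d)).exists
    obtain ⟨z, hz, hz'⟩ := intermediate_value_Icc' hb' F.cθ.continuousOn ⟨hb.le, hcon⟩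
    have := (hd i).2 ⟨by linarith [(hd i).1.1, hz.1], hz'⟩
    linarith [hz.1]
  have θd : ∀ i : ℕ, θ (d_ i) = -(i : ℝ) * Real.pi := fun i => (hd i).1.2
  have d1 : ∀ i : ℕ, 1 ≤ d_ i := fun i => (hd i).1.1
  have mono : ∀ i : ℕ, d_ i ≤ d_ (i+1) := by
    intro i
    by_contra hcon
    push Not at hcon
    have := after (i+1) _ hcon
    rw [θd] at this
    push_cast at this
    linarith
  have cR : Continuous R := by
    have : R = fun d => Real.sqrt (W d a ^ 2 + V d a ^ 2) := funext F.hR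
    rw [this]
    have c1 : Continuous fun d => W d a := F.cW.comp (by fun_prop : Continuous fun d : ℝ => (d, a))
    have c2 : Continuous fun d => V d a := F.cV.comp (by fun_prop : Continuous fun d : ℝ => (d, a))
    fun_prop
  have cθ := F.cθ
  have tend' : Tendsto (fun d => θ d + Real.pi) atTop atBot := tendsto_atBot_add_const_right _ _ F.tend
  have ne : ∀ i, x i ≠ x (i+1) := by
    intro i h
    rw [hx, hx] at h
    refine F.disj _ _ (d1 i) (d1 (i+1)) ⟨?_, h⟩
    rw [θd, θd]; push_cast; ring
  have up : ∀ i, x i < x (i+1) → x (i+1) < x (i+2) := by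
    intro i h
    rw [hx, hx] at h ⊢
    refine aux_order θ R (fun d => θ d + Real.pi) R cθ cR (by fun_prop) cR F.tend tend'
      (d_ i) (d_ (i+1)) (d_ (i+1)) (d_ (i+2)) (-(i:ℝ) * Real.pi) (-((i+1 : ℕ):ℝ) * Real.pi)
      (mono i) (mono (i+1)) (θd i) (by rw [θd]; push_cast; ring) (θd _) (by rw [θd]; push_cast; ring)
      (after i) (fun s hs => ?_) (after (i+1)) (fun s hs => ?_)
      (fun s hs t ht => F.disj s t ((d1 i).trans hs) ((d1 _).trans ht)) h
    · have := after (i+1) s hs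
      push_cast at this ⊢
      linarith
    · have := after (i+2) s hs
      push_cast at this ⊢
      linarith
  have dn : ∀ i, x (i+1) < x i → x (i+2) < x (i+1) := by
    intro i h
    rw [hx, hx] at h ⊢
    refine aux_order (fun d => θ d + Real.pi) R θ R (by fun_prop) cR cθ cR tend' F.tend
      (d_ (i+1)) (d_ (i+2)) (d_ i) (d_ (i+1)) (-(i:ℝ) * Real.pi) (-((i+1 : ℕ):ℝ) * Real.pi)
      (mono (i+1)) (mono i) (by rw [θd]; push_cast; ring) (θd i) (by rw [θd]; push_cast; ring) (θd _)
      (fun s hs => ?_) (after i) (fun s hs => ?_) (after (i+1))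
      (fun s hs t ht hh => F.disj t s ((d1 i).trans ht) ((d1 _).trans hs) ⟨hh.1.symm, hh.2.symm⟩) h
    · have := after (i+1) s hs
      push_cast at this ⊢
      linarith
    · have := after (i+2) s hs
      push_cast at this ⊢
      linarith
  constructor
  · rcases lt_or_gt_of_ne (ne 0) with h | h
    · left
      refine strictMono_nat_of_lt_succ fun i => ?_
      induction i with
      | zero => exact h
      | succ i ih => exact up i ih
    · right
      refine strictAnti_nat_of_succ_lt fun i => ?_
      induction i with
      | zero => exact h
      | succ i ih => exact dn i ih
  · rw [hx]
    have t0 := θd 0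
    have a0 := after 0
    simp only [Nat.cast_zero, neg_zero, zero_mul] at t0 a0
    exact F.x0 _ (d1 0) t0 a0

end AuxFam

end



/-- Lemma 4.6: the sequences `x_i = |I(d_i)|` and `y_j = |J(c_j)|` of radii at the exit
times `d_i = max{d ≥ 1 : θ(d) = -iπ}`, `c_j = max{c ≥ 1 : ϑ(c) = jπ}` are each either
strictly increasing or strictly decreasing, and `x₀, y₀ ≤ 1`. -/
theorem exit_time_radius_sequences_monotone
    (n ℓ m₁ m₂ : ℕ) (hn : 3 ≤ n) (hℓ : 1 ≤ ℓ) (hm₁ : 1 ≤ m₁) (hm₂ : 1 ≤ m₂)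
    (hm₁n : m₁ < n - 1) (hm₂n : m₂ < n - 1)
    (p lam : ℝ) (hp : p = ((n : ℝ) + 2) / ((n : ℝ) - 2))
    (hlam : lam = (n : ℝ) * ((n : ℝ) - 2) / (4 * (ℓ : ℝ) ^ 2))
    (h : ℝ → ℝ)
    (hh : ∀ r : ℝ, h r = (((m₁ : ℝ) + (m₂ : ℝ)) / 2) * Real.cos r - ((m₂ : ℝ) - (m₁ : ℝ)) / 2)
    (a₀ : ℝ) (ha₀ : a₀ ∈ Set.Ioo (0 : ℝ) Real.pi) (ha₀z : h a₀ = 0)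
    -- forward family
    (W : ℝ → ℝ → ℝ)
    (hWC2 : ∀ d : ℝ, ContDiffOn ℝ 2 (W d) (Set.Icc 0 a₀))
    (hWode : ∀ d : ℝ, ∀ r ∈ Set.Ioc (0 : ℝ) a₀,
      deriv (deriv (W d)) r + (h r / Real.sin r) * deriv (W d) r
        + lam * (|W d r| ^ (p - 1) * W d r - W d r) = 0)
    (hW0 : ∀ d : ℝ, W d 0 = d) (hW'0 : ∀ d : ℝ, deriv (W d) 0 = 0)
    (hWcont : Continuous fun q : ℝ × ℝ => (W q.1 q.2, deriv (W q.1) q.2))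
    (I : ℝ → ℝ × ℝ) (hI : ∀ d : ℝ, I d = (W d a₀, deriv (W d) a₀))
    (hInz : ∀ d : ℝ, d ≠ 0 → I d ≠ (0, 0))
    (θ : ℝ → ℝ) (hθc : ContinuousOn θ (Set.Ioi 0)) (hθ1 : θ 1 = 0)
    (hθ : ∀ d : ℝ, 0 < d →
      I d = (Real.sqrt ((I d).1 ^ 2 + (I d).2 ^ 2) * Real.cos (θ d),
             Real.sqrt ((I d).1 ^ 2 + (I d).2 ^ 2) * Real.sin (θ d)))
    -- backward family
    (Wt : ℝ → ℝ → ℝ)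
    (hWtC2 : ∀ c : ℝ, ContDiffOn ℝ 2 (Wt c) (Set.Icc a₀ Real.pi))
    (hWtode : ∀ c : ℝ, ∀ r ∈ Set.Ico a₀ Real.pi,
      deriv (deriv (Wt c)) r + (h r / Real.sin r) * deriv (Wt c) r
        + lam * (|Wt c r| ^ (p - 1) * Wt c r - Wt c r) = 0)
    (hWtπ : ∀ c : ℝ, Wt c Real.pi = c) (hWt'π : ∀ c : ℝ, deriv (Wt c) Real.pi = 0)
    (hWtcont : Continuous fun q : ℝ × ℝ => (Wt q.1 q.2, deriv (Wt q.1) q.2))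
    (J : ℝ → ℝ × ℝ) (hJ : ∀ c : ℝ, J c = (Wt c a₀, deriv (Wt c) a₀))
    (hJnz : ∀ c : ℝ, c ≠ 0 → J c ≠ (0, 0))
    (ϑ : ℝ → ℝ) (hϑc : ContinuousOn ϑ (Set.Ioi 0)) (hϑ1 : ϑ 1 = 0)
    (hϑ : ∀ c : ℝ, 0 < c →
      J c = (Real.sqrt ((J c).1 ^ 2 + (J c).2 ^ 2) * Real.cos (ϑ c),
             Real.sqrt ((J c).1 ^ 2 + (J c).2 ^ 2) * Real.sin (ϑ c)))
    -- the curves R and S are simple and meet only at (0,1)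
    (hRinj : Set.InjOn (fun d : ℝ => (θ d, Real.sqrt ((I d).1 ^ 2 + (I d).2 ^ 2))) (Set.Ici 1))
    (hSinj : Set.InjOn (fun c : ℝ => (ϑ c, Real.sqrt ((J c).1 ^ 2 + (J c).2 ^ 2))) (Set.Ici 1))
    (hRS : ((fun d : ℝ => (θ d, Real.sqrt ((I d).1 ^ 2 + (I d).2 ^ 2))) '' Set.Ici 1) ∩
        ((fun c : ℝ => (ϑ c, Real.sqrt ((J c).1 ^ 2 + (J c).2 ^ 2))) '' Set.Ici 1)
      = {((0 : ℝ), (1 : ℝ))})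
    -- the arguments tend to ∓∞
    (hθtend : Filter.Tendsto θ Filter.atTop Filter.atBot)
    (hϑtend : Filter.Tendsto ϑ Filter.atTop Filter.atTop)
    -- exit times
    (d_ : ℕ → ℝ) (hd : ∀ i : ℕ, IsGreatest {d : ℝ | 1 ≤ d ∧ θ d = -(i : ℝ) * Real.pi} (d_ i))
    (c_ : ℕ → ℝ) (hc : ∀ j : ℕ, IsGreatest {c : ℝ | 1 ≤ c ∧ ϑ c = (j : ℝ) * Real.pi} (c_ j))
    (x : ℕ → ℝ) (hx : ∀ i : ℕ, x i = Real.sqrt ((I (d_ i)).1 ^ 2 + (I (d_ i)).2 ^ 2))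
    (y : ℕ → ℝ) (hy : ∀ j : ℕ, y j = Real.sqrt ((J (c_ j)).1 ^ 2 + (J (c_ j)).2 ^ 2)) :
    (StrictMono x ∨ StrictAnti x) ∧ (StrictMono y ∨ StrictAnti y) ∧ x 0 ≤ 1 ∧ y 0 ≤ 1 := by
  have hpi := Real.pi_pos
  have hn' : (3 : ℝ) ≤ n := by exact_mod_cast hn
  have hℓ' : (1 : ℝ) ≤ ℓ := by exact_mod_cast hℓ
  have hm1' : (1 : ℝ) ≤ m₁ := by exact_mod_cast hm₁
  have hm2' : (1 : ℝ) ≤ m₂ := by exact_mod_cast hm₂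
  have hp1 : 1 < p := by
    rw [hp, lt_div_iff₀ (by linarith)]; linarith
  have hl0 : 0 < lam := by
    rw [hlam]
    have : (0:ℝ) < (n:ℝ) - 2 := by linarith
    positivity
  have hsin : ∀ r ∈ Set.Ioo 0 Real.pi, 0 < Real.sin r := fun r hr => Real.sin_pos_of_mem_Ioo hr
  have hcont : Continuous h := by
    have : h = fun r => (((m₁ : ℝ) + (m₂ : ℝ)) / 2) * Real.cos r - ((m₂ : ℝ) - (m₁ : ℝ)) / 2 := funext hh
    rw [this]; fun_prop
  have hanti : ∀ r s, 0 ≤ r → r < s → s ≤ Real.pi → h s < h r := by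
    intro r s hr hrs hs
    have := Real.cos_lt_cos_of_nonneg_of_le_pi hr hs hrs
    rw [hh, hh]
    have : (((m₁ : ℝ) + (m₂ : ℝ)) / 2) * Real.cos s < (((m₁ : ℝ) + (m₂ : ℝ)) / 2) * Real.cos r := by
      apply mul_lt_mul_of_pos_left this; linarith
    linarith
  have hmem : ((0 : ℝ), (1 : ℝ)) ∈ ((fun d : ℝ => (θ d, Real.sqrt ((I d).1 ^ 2 + (I d).2 ^ 2))) '' Set.Ici 1) ∩
        ((fun c : ℝ => (ϑ c, Real.sqrt ((J c).1 ^ 2 + (J c).2 ^ 2))) '' Set.Ici 1) := by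
    rw [hRS]; rfl
  obtain ⟨⟨d₁, hd₁, hd₁'⟩, ⟨c₁, hc₁, hc₁'⟩⟩ := hmem
  simp only [Prod.mk.injEq] at hd₁' hc₁'
  have hd₁ : 1 ≤ d₁ := hd₁
  have hc₁ : 1 ≤ c₁ := hc₁
  have c2 : ∀ (f : ℝ → ℝ) (u v r : ℝ), ContDiffOn ℝ 2 f (Set.Icc u v) → r ∈ Set.Ioo u v →
      DifferentiableAt ℝ f r ∧ DifferentiableAt ℝ (deriv f) r := by
    intro f u v r hf hr
    have hf' : ContDiffOn ℝ 2 f (Set.Ioo u v) := hf.mono Set.Ioo_subset_Icc_self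
    have hnh : Set.Ioo u v ∈ nhds r := isOpen_Ioo.mem_nhds hr
    refine ⟨(hf'.contDiffAt hnh).differentiableAt (by norm_num), ?_⟩
    have h2 : ContDiffOn ℝ 1 (deriv f) (Set.Ioo u v) :=
      ((contDiffOn_succ_iff_deriv_of_isOpen (n := 1) isOpen_Ioo).1 (by rw [one_add_one_eq_two]; exact hf')).2.2
    exact (h2.contDiffAt hnh).differentiableAt (by norm_num)
  -- forward family
  have F1 : AuxFam (fun r => h r / Real.sin r) lam p a₀ W (fun d r => deriv (W d) r)
      (fun d => θ (max 1 d)) (fun d => Real.sqrt ((I d).1 ^ 2 + (I d).2 ^ 2)) := by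
    have hlt : ∀ r ∈ Set.Ioc 0 a₀, r ∈ Set.Ioo 0 Real.pi := fun r hr => ⟨hr.1, hr.2.trans_lt ha₀.2⟩
    refine ⟨hp1, ha₀.1, hl0, ?_, ?_, ?_, hWcont.fst, hWcont.snd, hW0, hW'0, ?_, ?_, ?_, ?_, ?_, ?_, ?_⟩
    · exact hcont.continuousOn.div Real.continuous_sin.continuousOn (fun r hr => (hsin r (hlt r hr)).ne')
    · intro r hr
      have := hanti r a₀ hr.1.le hr.2 ha₀.2.le
      exact div_pos (by linarith) (hsin r (hlt r ⟨hr.1, hr.2.le⟩))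
    · intro d
      refine ⟨hWcont.fst.comp (by fun_prop : Continuous fun r : ℝ => (d, r)),
        hWcont.snd.comp (by fun_prop : Continuous fun r : ℝ => (d, r)), fun r hr => ?_, fun r hr => ?_⟩
      · exact (c2 _ _ _ r (hWC2 d) hr).1.hasDerivAt
      · have h1 := (c2 _ _ _ r (hWC2 d) hr).2.hasDerivAt
        have h2 := hWode d r ⟨hr.1, hr.2.le⟩
        exact h1.congr_deriv (by linarith)
    · exact hθc.comp_continuous (by fun_prop) (fun d => lt_of_lt_of_le one_pos (le_max_left 1 d))
    · simpa using hθ1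
    · intro d; simp [hI]
    · intro d hd
      have := congrArg Prod.fst (hθ d (by linarith))
      rw [max_eq_right hd]
      simpa only [hI] using this
    · intro d hd
      have := congrArg Prod.snd (hθ d (by linarith))
      rw [max_eq_right hd]
      simpa only [hI] using this
    · refine hθtend.congr' ?_
      filter_upwards [Filter.eventually_ge_atTop 1] with d hd
      rw [max_eq_right hd]
    · exact ⟨d₁, hd₁, by simpa [max_eq_right hd₁] using hd₁'.1, hd₁'.2⟩
  -- backward family, reflected
  have F2 : AuxFam (fun r => -(h (Real.pi - r) / Real.sin (Real.pi - r))) lam p (Real.pi - a₀)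
      (fun c r => Wt c (Real.pi - r)) (fun c r => -deriv (Wt c) (Real.pi - r))
      (fun c => -ϑ (max 1 c)) (fun c => Real.sqrt ((J c).1 ^ 2 + (J c).2 ^ 2)) := by
    have hlt : ∀ r ∈ Set.Ioc 0 (Real.pi - a₀), Real.pi - r ∈ Set.Ioo 0 Real.pi :=
      fun r hr => ⟨by linarith [hr.2, ha₀.1], by linarith [hr.1]⟩
    have hlt' : ∀ r ∈ Set.Ioo 0 (Real.pi - a₀), Real.pi - r ∈ Set.Ioo a₀ Real.pi :=
      fun r hr => ⟨by linarith [hr.2], by linarith [hr.1]⟩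
    have e0 : Real.pi - (Real.pi - a₀) = a₀ := by ring
    refine ⟨hp1, by linarith [ha₀.2], hl0, ?_, ?_, ?_,
      hWtcont.fst.comp (by fun_prop : Continuous fun q : ℝ × ℝ => (q.1, Real.pi - q.2)),
      (hWtcont.snd.comp (by fun_prop : Continuous fun q : ℝ × ℝ => (q.1, Real.pi - q.2))).neg,
      fun c => by simpa using hWtπ c, fun c => by simpa using hWt'π c, ?_, ?_, ?_, ?_, ?_, ?_, ?_⟩
    · refine ContinuousOn.neg (ContinuousOn.div ?_ ?_ (fun r hr => (hsin _ (hlt r hr)).ne'))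
      · exact (hcont.comp (by fun_prop)).continuousOn
      · exact (Real.continuous_sin.comp (by fun_prop)).continuousOn
    · intro r hr
      have h1 := hlt' r hr
      have := hanti a₀ (Real.pi - r) ha₀.1.le h1.1 h1.2.le
      have := div_neg_of_neg_of_pos (by linarith : h (Real.pi - r) < 0) (hsin _ (hlt r ⟨hr.1, hr.2.le⟩))
      linarith
    · intro d
      refine ⟨hWtcont.fst.comp (by fun_prop : Continuous fun r : ℝ => (d, Real.pi - r)),
        (hWtcont.snd.comp (by fun_prop : Continuous fun r : ℝ => (d, Real.pi - r))).neg,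
        fun r hr => ?_, fun r hr => ?_⟩
      · exact (c2 _ _ _ _ (hWtC2 d) (hlt' r hr)).1.hasDerivAt.comp_const_sub Real.pi r
      · have h1 := ((c2 _ _ _ _ (hWtC2 d) (hlt' r hr)).2.hasDerivAt.comp_const_sub Real.pi r).neg
        have h2 := hWtode d (Real.pi - r) ⟨(hlt' r hr).1.le, (hlt' r hr).2⟩
        exact h1.congr_deriv (by linarith)
    · exact (hϑc.comp_continuous (by fun_prop) (fun d => lt_of_lt_of_le one_pos (le_max_left 1 d))).neg
    · simpa using hϑ1
    · intro d; simp [hJ]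
    · intro d hd
      have := congrArg Prod.fst (hϑ d (by linarith))
      rw [max_eq_right hd, e0, Real.cos_neg]
      simpa only [hJ] using this
    · intro d hd
      have := congrArg Prod.snd (hϑ d (by linarith))
      rw [max_eq_right hd, e0, Real.sin_neg, mul_neg, neg_inj]
      simpa only [hJ] using this
    · refine (Filter.tendsto_neg_atTop_atBot.comp hϑtend).congr' ?_
      filter_upwards [Filter.eventually_ge_atTop 1] with d hd
      simp [max_eq_right hd]
    · exact ⟨c₁, hc₁, by simpa [max_eq_right hc₁] using hc₁'.1, hc₁'.2⟩
  have r1 := F1.main d_ (fun i => by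
    convert hd i using 1
    ext d
    simp only [Set.mem_setOf_eq]
    refine and_congr_right fun hd => ?_
    rw [max_eq_right hd]) x hx
  have r2 := F2.main c_ (fun i => by
    convert hc i using 1
    ext d
    simp only [Set.mem_setOf_eq]
    refine and_congr_right fun hd => ?_
    rw [max_eq_right hd, neg_mul, neg_inj]) y hy
  exact ⟨r1.1, r2.1, r1.2, r2.2⟩
end

section
/- Let P : ℝ → ℝ be a continuous odd function, let ε > 0, and let h : [π−ε, π] → ℝ be a continuous function with h(r) < 0 for all r ∈ [π−ε, π]. Let u : [π−ε, π) → ℝ be a C² function satisfying u''(r) + (h(r)/(π−r))·u'(r) + P(u(r)) = 0 for all r ∈ [π−ε, π). Assume that u is monotone and bounded on [π−ε, π) and that u' is bounded on [π−ε, π). Then u extends to a C¹ function on the closed interval [π−ε, π], and u'(π) = 0 (where u(π) and u'(π) denote the boundary values of the extension). -/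
theorem aux_bound (p : ℝ) (w w' : ℝ → ℝ) (r0 c K M : ℝ) (hr : r0 < p) (hc : 0 < c) (hK : 0 ≤ K)
    (hd : ∀ r ∈ Set.Ico r0 p, HasDerivAt w (w' r) r)
    (hw : ∀ r ∈ Set.Ico r0 p, 0 < w r → c * w r / (p - r) - K ≤ w' r)
    (hM : ∀ r ∈ Set.Ico r0 p, w r ≤ M) : c * w r0 ≤ K * (p - r0) := by
  by_contra! hcon
  have hs0 : 0 < p - r0 := by linarith
  have hw0 : 0 < w r0 := by
    have : 0 ≤ K * (p - r0) := by positivity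
    by_contra! h1
    nlinarith
  obtain ⟨η, hη, hη2⟩ : ∃ η, 0 < η ∧ η + K * (p - r0) < c * w r0 :=
    ⟨(c * w r0 - K * (p - r0)) / 2, by linarith, by linarith⟩
  have hM0 : 0 < M := lt_of_lt_of_le hw0 (hM r0 ⟨le_rfl, hr⟩)
  set b := p - (p - r0) * Real.exp (-(M / η)) with hb
  have he1 : Real.exp (-(M / η)) ≤ 1 := by
    rw [Real.exp_le_one_iff]
    have : 0 < M / η := by positivity
    linarith
  have he0 := Real.exp_pos (-(M / η))
  have hbr : r0 ≤ b := by rw [hb]; nlinarith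
  have hbp : b < p := by rw [hb]; nlinarith [mul_pos hs0 he0]
  have key := image_le_of_deriv_right_lt_deriv_boundary' (a := r0) (b := b)
    (f := fun r => - w r) (f' := fun r => - w' r)
    (B := fun r => - w r0 + η * (Real.log (p - r) - Real.log (p - r0)))
    (B' := fun r => η * (-1 / (p - r)))
    (fun r hr' => (hd r ⟨hr'.1, hr'.2.trans_lt hbp⟩).neg.continuousAt.continuousWithinAt)
    (fun r hr' => (hd r ⟨hr'.1, hr'.2.trans hbp⟩).neg.hasDerivWithinAt)
    (by simp)
    (by
      intro r hr'
      have : p - r ≠ 0 := by have := hr'.2; intro h; linarith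
      apply ContinuousAt.continuousWithinAt
      fun_prop (disch := assumption))
    (by
      intro r hr'
      have : p - r ≠ 0 := by have := hr'.2; intro h; linarith
      exact ((((((hasDerivAt_id r).const_sub p).log this).sub_const _).const_mul η).const_add _).hasDerivWithinAt)
    (by
      intro r hr' he
      have hs : 0 < p - r := by have := hr'.2; linarith
      have hlog : Real.log (p - r) ≤ Real.log (p - r0) :=
        Real.log_le_log hs (by linarith [hr'.1])
      have hwr : w r0 ≤ w r := by nlinarith
      have h1 := hw r ⟨hr'.1, hr'.2.trans hbp⟩ (by linarith)
      have h2 : η / (p - r) < c * w r / (p - r) - K := by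
        rw [lt_sub_iff_add_lt, div_add' _ _ _ hs.ne', div_lt_div_iff_of_pos_right hs]
        nlinarith [hr'.1]
      have h3 : η * (-1 / (p - r)) = - (η / (p - r)) := by ring
      rw [h3]; linarith)
  have h1 := key (x := b) ⟨hbr, le_rfl⟩
  have h2 := hM b ⟨hbr, hbp⟩
  have h3 : Real.log (p - b) = Real.log (p - r0) - M / η := by
    have : p - b = (p - r0) * Real.exp (-(M / η)) := by rw [hb]; ring
    rw [this, Real.log_mul hs0.ne' he0.ne', Real.log_exp]; ring
  simp only [h3] at h1
  have h4 : η * (Real.log (p - r0) - M / η - Real.log (p - r0)) = - M := by field_simp; ring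
  rw [h4] at h1
  linarith

/-- Lemma A.1: a monotone bounded solution of the singular ODE
`u'' + (h(r)/(π-r)) u' + P(u) = 0` on `[π-ε, π)` with bounded derivative extends to a
`C¹` function on `[π-ε, π]` with `u'(π) = 0`. -/
theorem singular_ODE_C1_extension_at_pi
    (P : ℝ → ℝ) (hP : Continuous P) (hPodd : ∀ x : ℝ, P (-x) = -P x)
    (ε : ℝ) (hε : 0 < ε)
    (h : ℝ → ℝ) (hh : ContinuousOn h (Set.Icc (Real.pi - ε) Real.pi))
    (hneg : ∀ r ∈ Set.Icc (Real.pi - ε) Real.pi, h r < 0)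
    (u : ℝ → ℝ) (hu : ContDiffOn ℝ 2 u (Set.Ico (Real.pi - ε) Real.pi))
    (hode : ∀ r ∈ Set.Ico (Real.pi - ε) Real.pi,
      deriv (deriv u) r + (h r / (Real.pi - r)) * deriv u r + P (u r) = 0)
    (hmono : MonotoneOn u (Set.Ico (Real.pi - ε) Real.pi) ∨
      AntitoneOn u (Set.Ico (Real.pi - ε) Real.pi))
    (hbdd : ∃ M : ℝ, ∀ r ∈ Set.Ico (Real.pi - ε) Real.pi, |u r| ≤ M)
    (hbdd' : ∃ M : ℝ, ∀ r ∈ Set.Ico (Real.pi - ε) Real.pi, |deriv u r| ≤ M) :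
    ∃ v : ℝ → ℝ,
      (∀ r ∈ Set.Ico (Real.pi - ε) Real.pi, v r = u r) ∧
      ContDiffOn ℝ 1 v (Set.Icc (Real.pi - ε) Real.pi) ∧
      derivWithin v (Set.Iic Real.pi) Real.pi = 0 := by
  obtain ⟨M, hM⟩ := hbdd
  obtain ⟨M', hM'⟩ := hbdd'
  set p := Real.pi with hp
  clear_value p
  have hlt : p - ε < p := by linarith
  obtain ⟨c, hc, hch⟩ : ∃ c, 0 < c ∧ ∀ r ∈ Set.Icc (p - ε) p, h r ≤ -c := by
    obtain ⟨x, hx, hmax⟩ := isCompact_Icc.exists_isMaxOn (Set.nonempty_Icc.2 hlt.le) hh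
    exact ⟨-h x, by linarith [hneg x hx], fun r hr => by simpa using hmax hr⟩
  obtain ⟨K, hK, hKP⟩ : ∃ K, 0 ≤ K ∧ ∀ r ∈ Set.Ico (p - ε) p, |P (u r)| ≤ K := by
    obtain ⟨C, hC⟩ := (isCompact_Icc (a := -M) (b := M)).exists_bound_of_continuousOn
      hP.continuousOn
    refine ⟨|C|, abs_nonneg _, fun r hr => ?_⟩
    exact (hC _ (abs_le.1 (hM r hr))).trans (le_abs_self _)
  have hcd : ∀ r ∈ Set.Ioo (p - ε) p, ContDiffAt ℝ 2 u r := fun r hr =>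
    hu.contDiffAt (Ico_mem_nhds hr.1 hr.2)
  have hdd : ∀ r ∈ Set.Ioo (p - ε) p, HasDerivAt (deriv u) (deriv (deriv u) r) r := by
    intro r hr
    have h1 : ContDiffAt ℝ 1 (deriv u) r :=
      ((hu.mono Set.Ioo_subset_Ico_self).deriv_of_isOpen (m := 1) isOpen_Ioo (by norm_num)).contDiffAt
        (Ioo_mem_nhds hr.1 hr.2)
    exact (h1.differentiableAt (by norm_num)).hasDerivAt
  have hbound : ∀ r ∈ Set.Ioo (p - ε) p, |deriv u r| ≤ K / c * (p - r) := by
    intro r hr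
    have hsub : ∀ x ∈ Set.Ico r p, x ∈ Set.Ioo (p - ε) p := fun x hx =>
      ⟨hr.1.trans_le hx.1, hx.2⟩
    have hsub' : ∀ x ∈ Set.Ico r p, x ∈ Set.Ico (p - ε) p := fun x hx =>
      ⟨(hr.1.trans_le hx.1).le, hx.2⟩
    have h1 := aux_bound p (deriv u) (deriv (deriv u)) r c K M' hr.2 hc hK
      (fun x hx => hdd x (hsub x hx))
      (by
        intro x hx hpos
        have hs : 0 < p - x := by linarith [hx.2]
        have e := hode x (hsub' x hx)
        have hk := abs_le.1 (hKP x (hsub' x hx))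
        have hc' := hch x ⟨(hsub' x hx).1, hx.2.le⟩
        have : h x / (p - x) * deriv u x ≤ - (c * deriv u x / (p - x)) := by
          rw [div_mul_eq_mul_div, ← neg_div]
          apply div_le_div_of_nonneg_right _ hs.le
          nlinarith
        linarith)
      (fun x hx => (abs_le.1 (hM' x (hsub' x hx))).2)
    have h2 := aux_bound p (fun x => - deriv u x) (fun x => - deriv (deriv u) x) r c K M' hr.2 hc hK
      (fun x hx => (hdd x (hsub x hx)).neg)
      (by
        intro x hx hpos
        have hs : 0 < p - x := by linarith [hx.2]
        have e := hode x (hsub' x hx)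
        have hk := abs_le.1 (hKP x (hsub' x hx))
        have hc' := hch x ⟨(hsub' x hx).1, hx.2.le⟩
        have : c * (- deriv u x) / (p - x) ≤ h x / (p - x) * deriv u x := by
          rw [div_mul_eq_mul_div]
          apply div_le_div_of_nonneg_right _ hs.le
          nlinarith
        linarith)
      (fun x hx => by linarith [(abs_le.1 (hM' x (hsub' x hx))).1])
    rw [div_mul_eq_mul_div, le_div_iff₀ hc]
    rcases abs_cases (deriv u r) with ⟨h3, _⟩ | ⟨h3, _⟩ <;> rw [h3] <;> linarith
  have hIoo : Set.Ioo (p - ε) p ∈ nhdsWithin p (Set.Iio p) := Ioo_mem_nhdsLT hlt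
  have htend : Filter.Tendsto (deriv u) (nhdsWithin p (Set.Iio p)) (nhds 0) := by
    refine squeeze_zero_norm' (a := fun r => K / c * (p - r)) ?_ ?_
    · filter_upwards [hIoo] with r hr using hbound r hr
    · have : Filter.Tendsto (fun r => K / c * (p - r)) (nhds p) (nhds (K / c * (p - p))) :=
        Continuous.tendsto (by fun_prop) p
      rw [sub_self, mul_zero] at this
      exact this.mono_left nhdsWithin_le_nhds
  obtain ⟨L, hL⟩ : ∃ L, Filter.Tendsto u (nhdsWithin p (Set.Iio p)) (nhds L) := by
    have hne : (Set.Ioo (p - ε) p).Nonempty := Set.nonempty_Ioo.2 hlt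
    have hs : Set.Ioo (p - ε) p ⊆ Set.Ico (p - ε) p := Set.Ioo_subset_Ico_self
    rcases hmono with hm | hm
    · exact ⟨_, MonotoneOn.tendsto_nhdsWithin_Ioo_left hne (hm.mono hs)
        ⟨M, by rintro _ ⟨x, hx, rfl⟩; exact (abs_le.1 (hM x (hs hx))).2⟩⟩
    · exact ⟨_, AntitoneOn.tendsto_nhdsWithin_Ioo_left hne (hm.mono hs)
        ⟨-M, by rintro _ ⟨x, hx, rfl⟩; exact (abs_le.1 (hM x (hs hx))).1⟩⟩
  set v : ℝ → ℝ := fun r => if r < p then u r else L with hv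
  have hvu : ∀ r, r < p → v r = u r := fun r hr => by simp [hv, hr]
  have hvp : v p = L := by simp [hv]
  have hvev : ∀ r, r < p → v =ᶠ[nhds r] u := fun r hr => by
    filter_upwards [Iio_mem_nhds hr] with x hx using hvu x hx
  have hvd : ∀ r, r < p → deriv v r = deriv u r := fun r hr => (hvev r hr).deriv_eq
  have hder : HasDerivWithinAt v 0 (Set.Iic p) p := by
    refine hasDerivWithinAt_Iic_of_tendsto_deriv (s := Set.Ioo (p - ε) p) ?_ ?_ hIoo ?_
    · intro r hr
      exact (((hcd r hr).differentiableAt (by norm_num)).congr_of_eventuallyEq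
        (hvev r hr.2)).differentiableWithinAt
    · rw [ContinuousWithinAt, hvp]
      have : Filter.Tendsto v (nhdsWithin p (Set.Iio p)) (nhds L) :=
        hL.congr' (by filter_upwards [self_mem_nhdsWithin] with x hx using (hvu x hx).symm)
      exact this.mono_left (nhdsWithin_mono _ (fun x hx => hx.2))
    · exact htend.congr' (by filter_upwards [self_mem_nhdsWithin] with x hx using (hvd x hx).symm)
  have huniq := uniqueDiffOn_Icc hlt
  have hset : ∀ r, r < p → Set.Icc (p - ε) p =ᶠ[nhds r] Set.Ico (p - ε) p := by
    intro r hr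
    filter_upwards [Iio_mem_nhds hr] with x hx
    have hx' : x < p := hx
    apply propext
    change (_ ∧ _) ↔ (_ ∧ _)
    simp [hx', hx'.le]
  have hvC : ContDiffOn ℝ 1 v (Set.Ico (p - ε) p) :=
    (hu.of_le (by norm_num)).congr (fun x hx => hvu x hx.2)
  have hdp : HasDerivWithinAt v 0 (Set.Icc (p - ε) p) p := hder.mono (fun x hx => hx.2)
  refine ⟨v, fun r hr => hvu r hr.2, ?_, hder.derivWithin (uniqueDiffWithinAt_Iic p)⟩
  rw [show (1 : WithTop ℕ∞) = 0 + 1 by simp, contDiffOn_succ_iff_derivWithin huniq]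
  refine ⟨?_, by simp, ?_⟩
  · intro r hr
    rcases hr.2.lt_or_eq with hrp | rfl
    · exact (differentiableWithinAt_congr_set (hset r hrp)).2
        (hvC.differentiableOn (by norm_num) r ⟨hr.1, hrp⟩)
    · exact hdp.differentiableWithinAt
  · rw [contDiffOn_zero]
    have hIco : ContinuousOn (derivWithin v (Set.Ico (p - ε) p)) (Set.Ico (p - ε) p) :=
      hvC.continuousOn_derivWithin (uniqueDiffOn_Ico _ _) (by norm_num)
    intro r hr
    rcases hr.2.lt_or_eq with hrp | hrp
    · have h1 := hIco r ⟨hr.1, hrp⟩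
      have h2 : derivWithin v (Set.Icc (p - ε) p) =ᶠ[nhds r] derivWithin v (Set.Ico (p - ε) p) := by
        filter_upwards [Iio_mem_nhds hrp] with x hx using derivWithin_congr_set (hset x hx)
      have h3 := h1.congr_of_eventuallyEq (h2.filter_mono nhdsWithin_le_nhds) h2.self_of_nhds
      exact h3.congr_set (hset r hrp).symm
    · rw [hrp]
      have h0 : derivWithin v (Set.Icc (p - ε) p) p = 0 :=
        hdp.derivWithin (huniq p ⟨hlt.le, le_rfl⟩)
      rw [← continuousWithinAt_sdiff_self, ContinuousWithinAt, h0, Set.Icc_sdiff_right,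
        nhdsWithin_Ico_eq_nhdsLT hlt]
      refine htend.congr' ?_
      filter_upwards [hIoo] with x hx
      rw [derivWithin_of_mem_nhds (Icc_mem_nhds hx.1 hx.2), hvd x hx.2]
end

section
/- Let P : ℝ → ℝ be a continuous odd function, let r₀ > 0, and let h : [π−r₀, π] → ℝ be a continuous function with h(π) < 0. Let u : (π−r₀, π] → ℝ be a function that is C¹ on (π−r₀, π], C² on (π−r₀, π), satisfies u''(r) + (h(r)/(π−r))·u'(r) + P(u(r)) = 0 for all r ∈ (π−r₀, π), and satisfies u'(π) = 0. Then u is C² on the whole interval (π−r₀, π], with second derivative at π equal to u''(π) = −P(u(π))/(1 − h(π)), and moreover lim_{s → 0⁺} (−u'(π−s)/s) = −P(u(π))/(1 − h(π)). -/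
open Set Filter Topology in
lemma aux_max (f : ℝ → ℝ) (d : ℝ) (hc : ContinuousOn f (Icc 0 d)) (h0 : f 0 = 0)
    (hd : ∀ s ∈ Ioc 0 d, 0 < f s → ∃ f', HasDerivAt f f' s ∧ f' < 0) (hd0 : 0 ≤ d) : f d ≤ 0 := by
  by_contra! hpos
  obtain ⟨m, hm, hmax⟩ := isCompact_Icc.exists_isMaxOn (nonempty_Icc.2 hd0) hc
  have hfm : 0 < f m := lt_of_lt_of_le hpos (hmax (right_mem_Icc.2 hd0))
  have hm0 : 0 < m := by
    rcases hm.1.eq_or_lt with h | h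
    · rw [← h, h0] at hfm; exact absurd hfm (lt_irrefl _)
    · exact h
  obtain ⟨f', hf', hneg⟩ := hd m ⟨hm0, hm.2⟩ hfm
  have ht := (hasDerivWithinAt_iff_tendsto_slope' (s := Iio m) (by simp)).1 hf'.hasDerivWithinAt
  have : 0 ≤ f' := by
    refine ge_of_tendsto ht ?_
    filter_upwards [Ioo_mem_nhdsLT hm0] with s hs
    rw [slope_def_field]
    have h1 : f s ≤ f m := hmax ⟨hs.1.le, hs.2.le.trans hm.2⟩
    exact div_nonneg_of_nonpos (by linarith) (by linarith [hs.2])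
  linarith

open Set Filter Topology in
lemma aux_lim (v H p : ℝ → ℝ) (d h0 p0 : ℝ) (hd : 0 < d) (hv : ContinuousOn v (Ico 0 d))
    (hv0 : v 0 = 0) (hder : ∀ s ∈ Ioo 0 d, HasDerivAt v (H s / s * v s + p s) s)
    (hH : Tendsto H (𝓝[>] 0) (𝓝 h0)) (hp : Tendsto p (𝓝[>] 0) (𝓝 p0)) (hneg : h0 < 0) :
    Tendsto (fun s => v s / s) (𝓝[>] 0) (𝓝 (p0 / (1 - h0))) := by
  set c := p0 / (1 - h0) with hcdef
  have hc : h0 * c + p0 - c = 0 := by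
    have : 1 - h0 ≠ 0 := by linarith
    rw [hcdef]; field_simp; ring
  have hg : Tendsto (fun s => H s * c + p s - c) (𝓝[>] 0) (𝓝 0) := by
    have := ((hH.mul_const c).add hp).sub_const c
    rwa [hc] at this
  rw [Metric.tendsto_nhds]
  intro ε hε
  have e1 : ∀ᶠ s in 𝓝[>] (0:ℝ), H s < 0 := hH.eventually_lt_const hneg
  have e2 : ∀ᶠ s in 𝓝[>] (0:ℝ), |H s * c + p s - c| < ε / 2 := by
    have := (Metric.tendsto_nhds.1 hg) (ε / 2) (by linarith)
    simpa [Real.dist_eq] using this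
  obtain ⟨δ, hδ, hsub⟩ := (mem_nhdsGT_iff_exists_Ioo_subset).1 ((e1.and e2).and (Ioo_mem_nhdsGT hd))
  have key : ∀ σ : ℝ, |σ| = 1 → ∀ t ∈ Ioo 0 δ, σ * (v t - c * t) - ε / 2 * t ≤ 0 := by
    intro σ hσ t ht
    refine aux_max (fun t => σ * (v t - c * t) - ε / 2 * t) t ?_ (by simp [hv0]) ?_ ht.1.le
    · have : ContinuousOn v (Icc 0 t) := hv.mono fun x hx =>
        ⟨hx.1, lt_of_le_of_lt hx.2 (hsub ht).2.2⟩
      fun_prop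
    · intro s hs hpos
      have hs' := hsub (show s ∈ Ioo 0 δ from ⟨hs.1, hs.2.trans_lt ht.2⟩)
      have hs0 := hs.1
      refine ⟨_, (((hder s hs'.2).sub ((hasDerivAt_id s).const_mul c)).const_mul σ).sub
        ((hasDerivAt_id s).const_mul (ε / 2)), ?_⟩
      have hgs : σ * (H s * c + p s - c) < ε / 2 := by
        refine lt_of_le_of_lt (le_abs_self _) ?_
        rw [abs_mul, hσ, one_mul]; exact hs'.1.2
      have hy : 0 < σ * (v s - c * s) := by
        have : 0 < ε / 2 * s := by positivity
        linarith
      have hHs : H s / s < 0 := div_neg_of_neg_of_pos hs'.1.1 hs0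
      have : H s / s * (σ * (v s - c * s)) < 0 := mul_neg_of_neg_of_pos hHs hy
      have e : H s / s * (c * s) = H s * c := by field_simp
      have e' : σ * (H s / s * v s + p s - c * 1) - ε / 2 * 1 =
        H s / s * (σ * (v s - c * s)) + (σ * (H s * c + p s - c) - ε / 2) := by
        rw [← e]; ring
      rw [e']; linarith
  filter_upwards [Ioo_mem_nhdsGT hδ] with t ht
  have h1 := key 1 (by simp) t ht
  have h2 := key (-1) (by simp) t ht
  have ht0 := ht.1
  have : v t / t - c = (v t - c * t) / t := by field_simp
  rw [Real.dist_eq, this, abs_div, abs_of_pos ht0, div_lt_iff₀ ht0]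
  have : ε / 2 * t < ε * t := by nlinarith
  rw [abs_lt]; constructor <;> linarith


/-- Lemma A.2: a `C¹` solution on `(π-r₀, π]` of the singular ODE with `u'(π) = 0` is in
fact `C²` up to `π`, with `u''(π) = -P(u(π))/(1 - h(π))`, and `-u'(π-s)/s` converges to
this value as `s → 0⁺`. -/
theorem singular_ODE_C2_extension_at_pi
    (P : ℝ → ℝ) (hP : Continuous P) (hPodd : ∀ x : ℝ, P (-x) = -P x)
    (r₀ : ℝ) (hr₀ : 0 < r₀)
    (h : ℝ → ℝ) (hh : ContinuousOn h (Set.Icc (Real.pi - r₀) Real.pi))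
    (hhπ : h Real.pi < 0)
    (u : ℝ → ℝ)
    (hu1 : ContDiffOn ℝ 1 u (Set.Ioc (Real.pi - r₀) Real.pi))
    (hu2 : ContDiffOn ℝ 2 u (Set.Ioo (Real.pi - r₀) Real.pi))
    (hode : ∀ r ∈ Set.Ioo (Real.pi - r₀) Real.pi,
      deriv (deriv u) r + (h r / (Real.pi - r)) * deriv u r + P (u r) = 0)
    (hu'π : derivWithin u (Set.Iic Real.pi) Real.pi = 0) :
    ContDiffOn ℝ 2 u (Set.Ioc (Real.pi - r₀) Real.pi) ∧
    derivWithin (derivWithin u (Set.Iic Real.pi)) (Set.Iic Real.pi) Real.pi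
      = -P (u Real.pi) / (1 - h Real.pi) ∧
    Filter.Tendsto (fun s : ℝ => -(deriv u (Real.pi - s)) / s)
      (nhdsWithin 0 (Set.Ioi 0)) (nhds (-P (u Real.pi) / (1 - h Real.pi))) := by
  open Set Filter Topology in
  set a := Real.pi - r₀ with ha
  have hab : a < Real.pi := by linarith
  generalize Real.pi = b at *
  set c := -P (u b) / (1 - h b) with hc
  set G := derivWithin u (Iic b) with hG
  have hU : UniqueDiffOn ℝ (Ioc a b) := uniqueDiffOn_Ioc a b
  have hset : ∀ x ∈ Ioc a b, Ioc a b =ᶠ[𝓝 x] Iic b := by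
    intro x hx
    filter_upwards [Ioi_mem_nhds hx.1] with y hy
    exact propext ⟨fun h => h.2, fun h => ⟨hy, h⟩⟩
  have hGI : ∀ x ∈ Ioc a b, derivWithin u (Ioc a b) x = G x := fun x hx =>
    derivWithin_congr_set (hset x hx)
  have hGd : ∀ x ∈ Ioo a b, G x = deriv u x := fun x hx =>
    derivWithin_of_mem_nhds (Iic_mem_nhds hx.2)
  obtain ⟨hdu, hcu⟩ := (contDiffOn_one_iff_derivWithin hU).1 hu1
  have hGc : ContinuousOn G (Ioc a b) := hcu.congr fun x hx => (hGI x hx).symm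
  have hu2' : ContDiffOn ℝ 1 (deriv u) (Ioo a b) :=
    ((contDiffOn_succ_iff_deriv_of_isOpen (n := 1) isOpen_Ioo).1
      (by simpa [one_add_one_eq_two] using hu2)).2.2
  have hdd : ∀ x ∈ Ioo a b, HasDerivAt (deriv u) (deriv (deriv u) x) x := fun x hx =>
    ((hu2'.differentiableOn one_ne_zero).differentiableAt (isOpen_Ioo.mem_nhds hx)).hasDerivAt
  have hGder : ∀ x ∈ Ioo a b, HasDerivAt G (deriv (deriv u) x) x := fun x hx =>
    (hdd x hx).congr_of_eventuallyEq (by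
      filter_upwards [isOpen_Ioo.mem_nhds hx] with y hy using hGd y hy)
  have hddc : ContinuousOn (deriv (deriv u)) (Ioo a b) :=
    hu2'.continuousOn_deriv_of_isOpen isOpen_Ioo le_rfl
  have hr : b - a = r₀ := by linarith
  have hsubt : Tendsto (fun s : ℝ => b - s) (𝓝[>] 0) (𝓝[Ioo a b] b) := by
    refine tendsto_nhdsWithin_iff.2 ⟨?_, ?_⟩
    · have : Tendsto (fun s : ℝ => b - s) (𝓝 0) (𝓝 (b - 0)) := by
        exact (continuous_const.sub continuous_id).tendsto 0
      rw [sub_zero] at this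
      exact this.mono_left nhdsWithin_le_nhds
    · filter_upwards [Ioo_mem_nhdsGT hr₀] with s hs
      exact ⟨by linarith [hs.2], by linarith [hs.1]⟩
  have hbI : b ∈ Ioc a b := ⟨hab, le_rfl⟩
  have hht : Tendsto h (𝓝[Ioo a b] b) (𝓝 (h b)) :=
    ((hh b ⟨hab.le, le_rfl⟩).mono Ioo_subset_Icc_self)
  have hut : Tendsto (fun x => P (u x)) (𝓝[Ioo a b] b) (𝓝 (P (u b))) :=
    (hP.tendsto _).comp ((hu1.continuousOn b hbI).mono Ioo_subset_Ioc_self)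
  have hlim := aux_lim (fun s => G (b - s)) (fun s => h (b - s)) (fun s => P (u (b - s))) r₀ (h b)
    (P (u b)) hr₀
    (hGc.comp (by fun_prop) fun s hs => ⟨by linarith [hs.2], by linarith [hs.1]⟩)
    (by simpa using hu'π)
    (by
      intro s hs
      have hm : b - s ∈ Ioo a b := ⟨by linarith [hs.2], by linarith [hs.1]⟩
      have h1 := (hGder (b - s) hm).comp s ((hasDerivAt_id s).const_sub b)
      have h2 := hode (b - s) hm
      refine HasDerivAt.congr_deriv h1 ?_
      rw [hGd _ hm]
      rw [sub_sub_cancel] at h2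
      linarith)
    (hht.comp hsubt) (hut.comp hsubt) hhπ
  have hlim3 : Tendsto (fun s => -(G (b - s)) / s) (𝓝[>] 0) (𝓝 c) := by
    have := hlim.neg
    simpa [hc, neg_div] using this
  have hback : Tendsto (fun x : ℝ => b - x) (𝓝[Ioo a b] b) (𝓝[>] 0) := by
    refine tendsto_nhdsWithin_iff.2 ⟨?_, ?_⟩
    · have : Tendsto (fun s : ℝ => b - s) (𝓝 b) (𝓝 (b - b)) := by
        exact (continuous_const.sub continuous_id).tendsto b
      rw [sub_self] at this
      exact this.mono_left nhdsWithin_le_nhds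
    · filter_upwards [self_mem_nhdsWithin] with s hs
      exact sub_pos.2 hs.2
  have hq : Tendsto (fun x => -(G x) / (b - x)) (𝓝[Ioo a b] b) (𝓝 c) := by
    have := hlim3.comp hback
    simpa [Function.comp_def] using this
  have hdiff : Ioc a b \ {b} = Ioo a b := Ioc_sdiff_right
  have hGb' : HasDerivWithinAt G c (Ioc a b) b := by
    rw [hasDerivWithinAt_iff_tendsto_slope, hdiff]
    refine hq.congr fun x => ?_
    rw [slope_def_field, hu'π, sub_zero, ← neg_sub b x, div_neg, neg_div]
  have hGb : HasDerivWithinAt G c (Iic b) b := by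
    rwa [hasDerivWithinAt_congr_set (hset b hbI)] at hGb'
  refine ⟨?_, hGb.derivWithin (uniqueDiffOn_Iic b b self_mem_Iic), ?_⟩
  · have hD : ∀ x ∈ Ioo a b, derivWithin G (Ioc a b) x = deriv (deriv u) x := fun x hx =>
      (hGder x hx).hasDerivWithinAt.derivWithin (hU x ⟨hx.1, hx.2.le⟩)
    have hDb : derivWithin G (Ioc a b) b = c := hGb'.derivWithin (hU b hbI)
    have hC1 : ContDiffOn ℝ 1 G (Ioc a b) := by
      rw [contDiffOn_one_iff_derivWithin hU]
      constructor
      · intro x hx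
        rcases hx.2.eq_or_lt with e | hlt
        · rw [e]; exact hGb'.differentiableWithinAt
        · exact (hGder x ⟨hx.1, hlt⟩).differentiableAt.differentiableWithinAt
      · intro x hx
        rcases hx.2.eq_or_lt with e | hlt
        · rw [e, ← continuousWithinAt_sdiff_self, hdiff]
          have hcc : h b * c - P (u b) = c := by
            have : 1 - h b ≠ 0 := by linarith
            rw [hc]; field_simp; ring
          unfold ContinuousWithinAt
          rw [hDb]
          have ht := (hht.mul hq).sub hut
          rw [hcc] at ht
          refine ht.congr' ?_
          filter_upwards [self_mem_nhdsWithin] with y hy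
          rw [hD y hy, hGd y hy]
          have := hode y hy
          rw [div_mul_eq_mul_div] at this
          rw [mul_div_assoc', mul_neg, neg_div]
          linarith
        · have hx' : x ∈ Ioo a b := ⟨hx.1, hlt⟩
          have hn := isOpen_Ioo.mem_nhds hx'
          refine ContinuousAt.continuousWithinAt ?_
          refine (hddc.continuousAt hn).congr ?_
          filter_upwards [hn] with y hy using (hD y hy).symm
    have := (contDiffOn_succ_iff_derivWithin (n := 1) hU).2
      ⟨hdu, by simp, hC1.congr hGI⟩
    simpa [one_add_one_eq_two] using this
  · refine hlim3.congr' ?_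
    filter_upwards [Ioo_mem_nhdsGT hr₀] with s hs
    rw [hGd (b - s) ⟨by linarith [hs.2], by linarith [hs.1]⟩]
end
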